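/- (Upper bound in the supercritical regime, Theorem 6.7, laminate case.) Assume W is continuous and satisfies (H1)–(H4) and that the wells are the supercritical wells A = −B = a ⊗ (e₁ + λe₃) for some a ∈ ℝ³∖{0} and λ ∈ ℝ. Let (u, b) be the laminate configuration with interfaces α₁ < ⋯ < α_m, and let h_n → 0⁺, ε_n → 0⁺ be arbitrary sequences with h_n/ε_n → ∞. Then there exists a sequence of C² maps u_n : ℝ³ → ℝ³ such that ∫_Ω (|u_n − u|^p + |∂₁u_n(x) − ū'(x₁)|^p + |∂₂u_n|^p) dx → 0, ∫_Ω |h_n⁻¹∂₃u_n − b|^p dx → 0, and limsup_{n→∞} F^{h_n}_{ε_n}(u_n, Ω) ≤ K_∞ · Σ_{i=1}^m ℒ¹(J_i). -/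

import Mathlib

open MeasureTheory Filter Topology ENNReal NNReal Set

noncomputable section

/-- Vectors in ℝ³. -/
abbrev V3 := Fin 3 → ℝ

/-- 3×3 matrices, represented as the triple of their columns. -/
abbrev M33 := Fin 3 → V3

/-- Euclidean norm on ℝ³. -/
def vnorm (v : V3) : ℝ := Real.sqrt (∑ i, (v i) ^ 2)

/-- Frobenius (Euclidean) norm on 3×3 matrices. -/
def mnorm (ξ : M33) : ℝ := Real.sqrt (∑ j, ∑ i, (ξ j i) ^ 2)

/-- dist(ξ,{A,B}). -/
def mdist (A B ξ : M33) : ℝ := min (mnorm (ξ - A)) (mnorm (ξ - B))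

/-- Spatial points of ℝ³ = ℝ × ℝ × ℝ. -/
abbrev Pt := ℝ × ℝ × ℝ

/-- Directional partial derivative of a map `u : ℝ³ → ℝ³`. -/
def pd (e : Pt) (u : Pt → V3) (x : Pt) : V3 := fderiv ℝ u x e

def e1 : Pt := (1, 0, 0)
def e2 : Pt := (0, 1, 0)
def e3 : Pt := (0, 0, 1)

/-- Rescaled gradient ∇_h u = (∂₁u, ∂₂u, h⁻¹ ∂₃u), as a 3×3 matrix of columns. -/
def gradh (h : ℝ) (u : Pt → V3) (x : Pt) : M33 :=
  ![pd e1 u x, pd e2 u x, h⁻¹ • pd e3 u x]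

/-- Squared rescaled Hessian |∇²_h u|². -/
def hessh (h : ℝ) (u : Pt → V3) (x : Pt) : ℝ :=
  (vnorm (pd e1 (pd e1 u) x)) ^ 2 + (vnorm (pd e2 (pd e2 u) x)) ^ 2
    + (h⁻¹) ^ 4 * (vnorm (pd e3 (pd e3 u) x)) ^ 2
    + 2 * (vnorm (pd e2 (pd e1 u) x)) ^ 2
    + 2 * (h⁻¹) ^ 2 * (vnorm (pd e3 (pd e1 u) x)) ^ 2
    + 2 * (h⁻¹) ^ 2 * (vnorm (pd e3 (pd e2 u) x)) ^ 2

/-- The energy F^h_ε(u, S) = ∫_S (1/ε) W(∇_h u) + ε |∇²_h u|², valued in [0,∞]. -/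
def F (W : M33 → ℝ) (h ε : ℝ) (u : Pt → V3) (S : Set Pt) : ℝ≥0∞ :=
  ∫⁻ x in S, ENNReal.ofReal (ε⁻¹ * W (gradh h u x) + ε * hessh h u x)

/-- Hypothesis (H1): W ≥ 0, {W = 0} = {A, B}, A ≠ B, and A' − B' = 2 a ⊗ ν̄ for
some a ∈ ℝ³ and a unit vector ν̄ ∈ ℝ². -/
def H1 (W : M33 → ℝ) (A B : M33) : Prop :=
  (∀ ξ, 0 ≤ W ξ) ∧ (∀ ξ, W ξ = 0 ↔ ξ = A ∨ ξ = B) ∧ A ≠ B ∧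
    ∃ (a : V3) (ν : ℝ × ℝ), ν.1 ^ 2 + ν.2 ^ 2 = 1 ∧
      A 0 - B 0 = (2 * ν.1) • a ∧ A 1 - B 1 = (2 * ν.2) • a

/-- Hypothesis (H2): p-growth from above and below. -/
def H2 (W : M33 → ℝ) (p : ℝ) : Prop :=
  ∃ C > (0 : ℝ), ∀ ξ, C⁻¹ * (mnorm ξ) ^ p - C ≤ W ξ ∧ W ξ ≤ C * (mnorm ξ) ^ p + C

/-- Hypothesis (H3): non-degeneracy near the wells. -/
def H3 (W : M33 → ℝ) (A B : M33) (p : ℝ) : Prop :=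
  ∃ ϱ > (0 : ℝ), ∃ C > (0 : ℝ), ∀ ξ, mdist A B ξ ≤ ϱ →
    C⁻¹ * (mdist A B ξ) ^ p ≤ W ξ ∧ W ξ ≤ C * (mdist A B ξ) ^ p

/-- Hypothesis (H4): W(ξ₁, 0, ξ₃) ≤ W(ξ). -/
def H4 (W : M33 → ℝ) : Prop := ∀ ξ : M33, W ![ξ 0, 0, ξ 2] ≤ W ξ

/-- Normalization of the wells: A = −B, first column of A is a, second column is 0. -/
def Wells (A B : M33) (a : V3) : Prop := A = -B ∧ A 0 = a ∧ A 1 = 0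

/-- ū₀(t) = |t| a. -/
def ub0 (a : V3) (t : ℝ) : V3 := |t| • a

/-- b̄₀(t) = A₃ for t ≥ 0, −A₃ (= B₃) for t < 0. -/
def bb0 (A3 : V3) (t : ℝ) : V3 := if 0 ≤ t then A3 else -A3

/-- u₀(x) = ū₀(x₁). -/
def u0 (a : V3) (x : Pt) : V3 := ub0 a x.1

/-- b₀(x) = b̄₀(x₁). -/
def b0 (A3 : V3) (x : Pt) : V3 := bb0 A3 x.1

/-- The interval I = (−1/2, 1/2). -/
def II : Set ℝ := Set.Ioo (-(1 / 2 : ℝ)) (1 / 2)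

/-- The unit cube Q = I × I × I. -/
def Q3 : Set Pt := II ×ˢ (II ×ˢ II)

/-- J_ρ = (ρ I) × J × I. -/
def Jrho (J : Set ℝ) (ρ : ℝ) : Set Pt := (Set.Ioo (-(ρ / 2)) (ρ / 2)) ×ˢ (J ×ˢ II)

/-- The rescaled thin domain Ω = ω × I. -/
def Om (ω : Set (ℝ × ℝ)) : Set Pt := {x | (x.1, x.2.1) ∈ ω ∧ x.2.2 ∈ II}

/-- L¹ convergence on a set U. -/
def TendsL1 (U : Set Pt) (f : ℕ → Pt → V3) (g : Pt → V3) : Prop :=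
  Tendsto (fun n => ∫⁻ x in U, ENNReal.ofReal (vnorm (f n x - g x))) atTop (nhds 0)

/-- L^q convergence on a set U. -/
def TendsLp (U : Set Pt) (q : ℝ) (f : ℕ → Pt → V3) (g : Pt → V3) : Prop :=
  Tendsto (fun n => ∫⁻ x in U, ENNReal.ofReal ((vnorm (f n x - g x)) ^ q)) atTop (nhds 0)

/-- The localized asymptotic energy 𝓔_γ(J, ρ). -/
def Egam (W : M33 → ℝ) (a A3 : V3) (γ : ℝ) (J : Set ℝ) (ρ : ℝ) : ℝ≥0∞ :=
  sInf { L : ℝ≥0∞ | ∃ (h ε : ℕ → ℝ) (u : ℕ → Pt → V3),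
    (∀ n, 0 < h n) ∧ (∀ n, 0 < ε n) ∧
    Tendsto h atTop (nhds 0) ∧ Tendsto ε atTop (nhds 0) ∧
    Tendsto (fun n => h n / ε n) atTop (nhds γ) ∧
    (∀ n, ContDiffOn ℝ 2 (u n) (Jrho J ρ)) ∧
    TendsL1 (Jrho J ρ) u (u0 a) ∧
    TendsL1 (Jrho J ρ) (fun n x => (h n)⁻¹ • pd e3 (u n) x) (b0 A3) ∧
    L = Filter.liminf (fun n => F W (h n) (ε n) (u n) (Jrho J ρ)) atTop }

/-- K*_γ = 𝓔_γ(I, 1). -/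
def Kstar (W : M33 → ℝ) (a A3 : V3) (γ : ℝ) : ℝ≥0∞ := Egam W a A3 γ II 1

/-- K*_∞ : the analogue of K*_γ for h/ε → ∞, on the unit cube Q. -/
def KstarInf (W : M33 → ℝ) (a A3 : V3) : ℝ≥0∞ :=
  sInf { L : ℝ≥0∞ | ∃ (h ε : ℕ → ℝ) (u : ℕ → Pt → V3),
    (∀ n, 0 < h n) ∧ (∀ n, 0 < ε n) ∧
    Tendsto h atTop (nhds 0) ∧ Tendsto ε atTop (nhds 0) ∧
    Tendsto (fun n => h n / ε n) atTop atTop ∧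
    (∀ n, ContDiffOn ℝ 2 (u n) Q3) ∧
    TendsL1 Q3 u (u0 a) ∧
    TendsL1 Q3 (fun n x => (h n)⁻¹ • pd e3 (u n) x) (b0 A3) ∧
    L = Filter.liminf (fun n => F W (h n) (ε n) (u n) Q3) atTop }

open Classical in
/-- The phase matrix: B on E, A off E. -/
def Mfun (A B : M33) (E : Set (ℝ × ℝ)) (x' : ℝ × ℝ) : M33 := if x' ∈ E then B else A

/-! ### Two-dimensional objects -/

abbrev Pt2 := ℝ × ℝ

/-- Directional partial derivative of a map `v : ℝ² → ℝ³`. -/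
def qd (e : Pt2) (v : Pt2 → V3) (y : Pt2) : V3 := fderiv ℝ v y e

def f1 : Pt2 := (1, 0)
def f2 : Pt2 := (0, 1)

/-- 𝒲(∇v) = W(∂₁v, 0, ∂₂v). -/
def W2 (W : M33 → ℝ) (v : Pt2 → V3) (y : Pt2) : ℝ := W ![qd f1 v y, 0, qd f2 v y]

/-- Squared 2D Hessian |∇²v|². -/
def hess2d (v : Pt2 → V3) (y : Pt2) : ℝ :=
  (vnorm (qd f1 (qd f1 v) y)) ^ 2 + 2 * (vnorm (qd f2 (qd f1 v) y)) ^ 2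
    + (vnorm (qd f2 (qd f2 v) y)) ^ 2

/-- The rectangle ℓI × γI. -/
def Rect (ℓ γ : ℝ) : Set Pt2 := Set.Ioo (-(ℓ / 2)) (ℓ / 2) ×ˢ Set.Ioo (-(γ / 2)) (γ / 2)

/-- The optimal-profile constant K_γ of the critical regime. -/
def Kgam (W : M33 → ℝ) (a A3 : V3) (γ : ℝ) : ℝ≥0∞ :=
  sInf { L : ℝ≥0∞ | ∃ ℓ > (0 : ℝ), ∃ v : Pt2 → V3,
    ContDiffOn ℝ 2 v (Rect ℓ γ) ∧
    (∃ δ > (0 : ℝ), ∀ y ∈ Rect ℓ γ, ℓ / 2 - δ < y.1 → qd f1 v y = a ∧ qd f2 v y = A3) ∧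
    (∃ δ > (0 : ℝ), ∀ y ∈ Rect ℓ γ, y.1 < -(ℓ / 2) + δ → qd f1 v y = -a ∧ qd f2 v y = -A3) ∧
    L = ENNReal.ofReal γ⁻¹ *
      ∫⁻ y in Rect ℓ γ, ENNReal.ofReal (W2 W v y + hess2d v y) }

/-- The 2D subcritical functional F⁰_ε(u, b, D). -/
def F0 (W : M33 → ℝ) (ε : ℝ) (u b : Pt2 → V3) (D : Set Pt2) : ℝ≥0∞ :=
  ∫⁻ y in D, ENNReal.ofReal (ε⁻¹ * W ![qd f1 u y, qd f2 u y, b y]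
    + ε * ((vnorm (qd f1 (qd f1 u) y)) ^ 2 + 2 * (vnorm (qd f2 (qd f1 u) y)) ^ 2
      + (vnorm (qd f2 (qd f2 u) y)) ^ 2
      + 2 * (vnorm (qd f1 b y)) ^ 2 + 2 * (vnorm (qd f2 b y)) ^ 2))

/-- K*₀: the subcritical cell constant. -/
def Kstar0 (W : M33 → ℝ) (a A3 : V3) : ℝ≥0∞ :=
  sInf { L : ℝ≥0∞ | ∃ (ε : ℕ → ℝ) (u b : ℕ → Pt2 → V3),
    (∀ n, 0 < ε n) ∧ Tendsto ε atTop (nhds 0) ∧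
    (∀ n, ContDiffOn ℝ 2 (u n) (II ×ˢ II)) ∧ (∀ n, ContDiffOn ℝ 1 (b n) (II ×ˢ II)) ∧
    Tendsto (fun n => ∫⁻ y in II ×ˢ II,
      ENNReal.ofReal (vnorm (u n y - ub0 a y.1) + vnorm (b n y - bb0 A3 y.1)))
      atTop (nhds 0) ∧
    L = Filter.liminf (fun n => F0 W (ε n) (u n) (b n) (II ×ˢ II)) atTop }

/-- K₀: the subcritical optimal-profile constant. -/
def K0 (W : M33 → ℝ) (a A3 : V3) : ℝ≥0∞ :=
  sInf { L : ℝ≥0∞ | ∃ ℓ > (0 : ℝ), ∃ φ1 φ2 : ℝ → V3,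
    ContDiffOn ℝ 1 φ1 (Set.Icc (-ℓ) ℓ) ∧ ContDiffOn ℝ 1 φ2 (Set.Icc (-ℓ) ℓ) ∧
    φ1 ℓ = a ∧ φ2 ℓ = A3 ∧ φ1 (-ℓ) = -a ∧ φ2 (-ℓ) = -A3 ∧
    L = ∫⁻ t in Set.Ioo (-ℓ) ℓ, ENNReal.ofReal (W ![φ1 t, 0, φ2 t]
      + (vnorm (derivWithin φ1 (Set.Icc (-ℓ) ℓ) t)) ^ 2
      + 2 * (vnorm (derivWithin φ2 (Set.Icc (-ℓ) ℓ) t)) ^ 2) }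

/-- K_∞ in the case λ = 0. -/
def KinfZero (W : M33 → ℝ) (a : V3) : ℝ≥0∞ :=
  sInf { L : ℝ≥0∞ | ∃ ℓ > (0 : ℝ), ∃ v : Pt2 → V3,
    ContDiff ℝ 2 v ∧ (∀ y : Pt2, v (y.1, y.2 + 1) = v y) ∧
    (∃ δ > (0 : ℝ), ∀ y : Pt2, |y.1 - 1 / 2| < δ → qd f1 v y = a ∧ qd f2 v y = 0) ∧
    (∃ δ > (0 : ℝ), ∀ y : Pt2, |y.1 + 1 / 2| < δ → qd f1 v y = -a ∧ qd f2 v y = 0) ∧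
    L = ∫⁻ y in II ×ˢ II, ENNReal.ofReal (ℓ * W2 W v y + ℓ⁻¹ * hess2d v y) }

/-- The unit normal ν_λ = (1+λ²)^{-1/2} (1, λ). -/
def nuv (lam : ℝ) : Pt2 := (1 / Real.sqrt (1 + lam ^ 2), lam / Real.sqrt (1 + lam ^ 2))

/-- The orthogonal direction ν_λ^⊥ = (1+λ²)^{-1/2} (−λ, 1). -/
def nupv (lam : ℝ) : Pt2 := (-lam / Real.sqrt (1 + lam ^ 2), 1 / Real.sqrt (1 + lam ^ 2))

/-- Dot product on ℝ². -/
def dotp (w y : Pt2) : ℝ := w.1 * y.1 + w.2 * y.2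

/-- The unit square Q'_λ centered at 0 with two sides orthogonal to ν_λ. -/
def Qlam (lam : ℝ) : Set Pt2 := {y | |dotp (nuv lam) y| < 1 / 2 ∧ |dotp (nupv lam) y| < 1 / 2}

/-- K_∞ for general λ. -/
def KinfL (W : M33 → ℝ) (a : V3) (lam : ℝ) : ℝ≥0∞ :=
  ENNReal.ofReal (Real.sqrt (1 + lam ^ 2)) *
    sInf { L : ℝ≥0∞ | ∃ ℓ > (0 : ℝ), ∃ v : Pt2 → V3,
      ContDiff ℝ 2 v ∧ (∀ y : Pt2, v (y + nupv lam) = v y) ∧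
      (∃ δ > (0 : ℝ), ∀ y : Pt2, |dotp (nuv lam) y - 1 / 2| < δ →
        qd f1 v y = a ∧ qd f2 v y = lam • a) ∧
      (∃ δ > (0 : ℝ), ∀ y : Pt2, |dotp (nuv lam) y + 1 / 2| < δ →
        qd f1 v y = -a ∧ qd f2 v y = -(lam • a)) ∧
      L = ∫⁻ y in Qlam lam, ENNReal.ofReal (ℓ * W2 W v y + ℓ⁻¹ * hess2d v y) }

/-- Number of interfaces strictly below t. -/
def cnt (m : ℕ) (α : Fin m → ℝ) (t : ℝ) : ℕ := (Finset.univ.filter (fun i => α i < t)).card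

end

section

open scoped Pointwise

theorem Function.Periodic.setLIntegral_Ioc_eq {f : ℝ → ℝ≥0∞} (hf : Function.Periodic f 1)
    (s t : ℝ) : ∫⁻ x in Ioc s (s + 1), f x = ∫⁻ x in Ioc t (t + 1), f x :=
  (isAddFundamentalDomain_Ioc one_pos s).setLIntegral_eq (isAddFundamentalDomain_Ioc one_pos t) f
    hf.map_vadd_zmultiples

theorem Function.Periodic.setLIntegral_Ioo_le {f : ℝ → ℝ≥0∞} (hf : Function.Periodic f 1)
    (s t R : ℝ) (hR : 0 ≤ R) :
    ∫⁻ x in Ioo s (s + R), f x ≤ ENNReal.ofReal (R + 1) * ∫⁻ x in Ioo t (t + 1), f x := by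
  have hN : (⌈R⌉₊ : ℝ) ≤ R + 1 := (Nat.ceil_lt_add_one hR).le
  have key : ∀ N : ℕ, ∫⁻ x in Ioc s (s + N), f x = N * ∫⁻ x in Ioc t (t + 1), f x := by
    intro N
    induction N with
    | zero => simp
    | succ N ih =>
      have : Ioc s (s + (N + 1 : ℕ)) = Ioc s (s + N) ∪ Ioc (s + N) (s + N + 1) := by
        rw [Ioc_union_Ioc_eq_Ioc] <;> push_cast <;> first | linarith | simp [add_assoc]
      rw [this, lintegral_union measurableSet_Ioc (Ioc_disjoint_Ioc_of_le le_rfl), ih,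
        hf.setLIntegral_Ioc_eq (s + N) t]
      push_cast
      ring
  calc ∫⁻ x in Ioo s (s + R), f x ≤ ∫⁻ x in Ioc s (s + ⌈R⌉₊), f x := by
        apply lintegral_mono_set
        intro x hx
        exact ⟨hx.1, by linarith [hx.2, Nat.le_ceil R]⟩
    _ = ⌈R⌉₊ * ∫⁻ x in Ioo t (t + 1), f x := by rw [key, restrict_Ioo_eq_restrict_Ioc]
    _ ≤ _ := by
        rw [← ENNReal.ofReal_natCast]
        gcongr

/-- Change of variables along an invertible linear map of the plane followed by a translation. -/
theorem lintegral_comp_matrix_add (m11 m12 m21 m22 : ℝ) (b : ℝ × ℝ)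
    (hdet : m11 * m22 - m12 * m21 ≠ 0) {f : ℝ × ℝ → ℝ≥0∞} (hf : Measurable f) :
    ∫⁻ z : ℝ × ℝ, f (m11 * z.1 + m12 * z.2 + b.1, m21 * z.1 + m22 * z.2 + b.2) =
      ENNReal.ofReal |(m11 * m22 - m12 * m21)⁻¹| * ∫⁻ x, f x := by
  set M : (ℝ × ℝ) →ₗ[ℝ] (ℝ × ℝ) :=
    Matrix.toLin (Module.Basis.finTwoProd ℝ) (Module.Basis.finTwoProd ℝ) !![m11, m12; m21, m22]
  have hM : ∀ z, M z = (m11 * z.1 + m12 * z.2, m21 * z.1 + m22 * z.2) := fun z => by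
    simp [M, Matrix.toLin_finTwoProd_apply]
  have hd : LinearMap.det M = m11 * m22 - m12 * m21 := by
    simp [M, LinearMap.det_toLin, Matrix.det_fin_two]
  have hmap := Measure.map_linearMap_addHaar_eq_smul_addHaar (volume : Measure (ℝ × ℝ))
    (f := M) (by rwa [hd])
  have hMm : Measurable M := (LinearMap.continuous_of_finiteDimensional M).measurable
  calc ∫⁻ z : ℝ × ℝ, f (m11 * z.1 + m12 * z.2 + b.1, m21 * z.1 + m22 * z.2 + b.2)
      = ∫⁻ z, (fun y => f (y + b)) (M z) := by simp only [hM]; rfl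
    _ = ∫⁻ y, f (y + b) ∂(Measure.map M volume) :=
        (lintegral_map (hf.comp (measurable_id.add_const b)) hMm).symm
    _ = _ := by
        rw [hmap, lintegral_smul_measure, lintegral_add_right_eq_self f b, hd, smul_eq_mul]

/-- The length of the slices of a planar convex set is upper semicontinuous at interior slices. -/
theorem Convex.eventually_volume_slice_le {ω : Set (ℝ × ℝ)} (hωc : Convex ℝ ω) {α : ℝ}
    (hα : sInf (Prod.fst '' ω) < α ∧ α < sSup (Prod.fst '' ω)) (hne : ω.Nonempty)
    {c : ℝ≥0∞}
    (hc : volume {t : ℝ | (α, t) ∈ ω} < c) :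
    ∀ᶠ x in 𝓝 α, volume {t : ℝ | (x, t) ∈ ω} ≤ c := by
  obtain ⟨_, ⟨P, hP, rfl⟩, hPα⟩ := exists_lt_of_csInf_lt (hne.image _) hα.1
  obtain ⟨_, ⟨Q, hQ, rfl⟩, hQα⟩ := exists_lt_of_lt_csSup (hne.image _) hα.2
  have main : ∀ R ∈ ω, ∀ x s : ℝ, 0 ≤ s → s < 1 → (1 - s) * x + s * R.1 = α →
      ENNReal.ofReal (1 - s) * volume {t : ℝ | (x, t) ∈ ω} ≤ volume {t : ℝ | (α, t) ∈ ω} := by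
    intro R hR x s hs0 hs1 hx
    have h1s : (1 - s) ≠ 0 := by linarith
    calc ENNReal.ofReal (1 - s) * volume {t : ℝ | (x, t) ∈ ω}
        = volume ((fun y => y + s * R.2) '' ((fun t => (1 - s) * t) '' {t : ℝ | (x, t) ∈ ω})) := by
          have e1 : (fun t : ℝ => (1 - s) * t) '' {t : ℝ | (x, t) ∈ ω} =
              (1 - s) • {t : ℝ | (x, t) ∈ ω} := by
            ext; simp [Set.mem_smul_set]
          rw [e1, image_add_right, measure_preimage_add_right, Measure.addHaar_smul]
          simp [abs_of_pos (sub_pos.2 hs1)]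
      _ ≤ _ := by
          apply measure_mono
          rintro _ ⟨_, ⟨t, ht, rfl⟩, rfl⟩
          have := hωc ht hR (sub_nonneg.2 hs1.le) hs0 (by ring)
          simp only [mem_ofPred_eq]
          convert this using 1
          ext <;> simp [hx]
  have bound : ∀ s : ℝ, 0 ≤ s → s < 1 → ∀ x : ℝ, volume {t : ℝ | (α, t) ∈ ω} ≤
      ENNReal.ofReal (1 - s) * c →
      ENNReal.ofReal (1 - s) * volume {t : ℝ | (x, t) ∈ ω} ≤ volume {t : ℝ | (α, t) ∈ ω} →
      volume {t : ℝ | (x, t) ∈ ω} ≤ c := by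
    intro s _ hs1 x h1 h2
    have := h2.trans h1
    exact (ENNReal.mul_le_mul_iff_right (by simpa using hs1) ENNReal.ofReal_ne_top).1 this
  have small : ∀ R : ℝ × ℝ, R.1 ≠ α →
      Tendsto (fun x : ℝ => (x - α) / (x - R.1)) (𝓝 α) (𝓝 0) := by
    intro R hR
    have : Tendsto (fun x : ℝ => (x - α) / (x - R.1)) (𝓝 α) (𝓝 ((α - α) / (α - R.1))) := by
      apply ContinuousAt.tendsto (f := fun x : ℝ => (x - α) / (x - R.1))
      exact ContinuousAt.div (by fun_prop) (by fun_prop) (sub_ne_zero.2 hR.symm)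
    simpa using this
  have smallc : ∀ R : ℝ × ℝ, R.1 ≠ α →
      ∀ᶠ x in 𝓝 α, volume {t : ℝ | (α, t) ∈ ω} ≤
        ENNReal.ofReal (1 - (x - α) / (x - R.1)) * c := by
    intro R hR
    rcases eq_or_ne c ⊤ with rfl | hcT
    · have h1 : Tendsto (fun x : ℝ => 1 - (x - α) / (x - R.1)) (𝓝 α) (𝓝 (1 - 0)) :=
        tendsto_const_nhds.sub (small R hR)
      filter_upwards [h1.eventually_const_lt (show (0 : ℝ) < 1 - 0 by norm_num)] with x hx
      rw [ENNReal.mul_top (by simpa using hx)]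
      exact le_top
    have h1 : Tendsto (fun x : ℝ => ENNReal.ofReal (1 - (x - α) / (x - R.1)) * c) (𝓝 α)
        (𝓝 (ENNReal.ofReal (1 - 0) * c)) :=
      ENNReal.Tendsto.mul_const
        (ENNReal.tendsto_ofReal (tendsto_const_nhds.sub (small R hR))) (Or.inr hcT)
    filter_upwards [h1.eventually_const_lt (show volume {t : ℝ | (α, t) ∈ ω} < _ by simpa using hc)]
      with x hx using hx.le
  filter_upwards [smallc P hPα.ne, smallc Q hQα.ne', eventually_gt_nhds hPα,
    eventually_lt_nhds hQα] with x hxP hxQ h1 h2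
  rcases le_total α x with hx | hx
  · have hd : 0 < x - P.1 := by linarith
    refine bound ((x - α) / (x - P.1)) (div_nonneg (by linarith) hd.le)
      ((div_lt_one hd).2 (by linarith)) x hxP (main P hP x _ (div_nonneg (by linarith) hd.le)
      ((div_lt_one hd).2 (by linarith)) ?_)
    field_simp
    ring
  · have hd : x - Q.1 < 0 := by linarith
    have e1 : 0 ≤ (x - α) / (x - Q.1) := div_nonneg_of_nonpos (by linarith) hd.le
    have e2 : (x - α) / (x - Q.1) < 1 := (div_lt_one_of_neg hd).2 (by linarith)
    refine bound _ e1 e2 x hxQ (main Q hQ x _ e1 e2 ?_)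
    have := hd.ne
    field_simp
    ring

theorem sqrt_one_add_sq_pos (lam : ℝ) : 0 < Real.sqrt (1 + lam ^ 2) :=
  Real.sqrt_pos.2 (by positivity)

theorem dotp_nuv (lam : ℝ) (y : Pt2) :
    dotp (nuv lam) y = (y.1 + lam * y.2) / Real.sqrt (1 + lam ^ 2) := by
  simp only [dotp, nuv]; ring

theorem dotp_nuv_add_nupv (lam : ℝ) (y : Pt2) :
    dotp (nuv lam) (y + nupv lam) = dotp (nuv lam) y := by
  simp only [dotp_nuv, nupv, Prod.fst_add, Prod.snd_add]
  ring

/-- Rotated coordinates adapted to the interface normal. -/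
theorem dotp_nuv_rot (lam P Q : ℝ) :
    dotp (nuv lam) (P • nuv lam + Q • nupv lam) = P := by
  have h := sqrt_one_add_sq_pos lam
  have h2 : Real.sqrt (1 + lam ^ 2) ^ 2 = 1 + lam ^ 2 := Real.sq_sqrt (by positivity)
  simp only [dotp, nuv, nupv, Prod.fst_add, Prod.snd_add, Prod.smul_mk, smul_eq_mul]
  field_simp
  rw [h2]; ring

theorem dotp_nupv_rot (lam P Q : ℝ) :
    dotp (nupv lam) (P • nuv lam + Q • nupv lam) = Q := by
  have h := sqrt_one_add_sq_pos lam
  have h2 : Real.sqrt (1 + lam ^ 2) ^ 2 = 1 + lam ^ 2 := Real.sq_sqrt (by positivity)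
  simp only [dotp, nuv, nupv, Prod.fst_add, Prod.snd_add, Prod.smul_mk, smul_eq_mul]
  field_simp
  rw [h2]; ring

theorem rot_dotp (lam : ℝ) (y : Pt2) :
    dotp (nuv lam) y • nuv lam + dotp (nupv lam) y • nupv lam = y := by
  have h := sqrt_one_add_sq_pos lam
  have h2 : Real.sqrt (1 + lam ^ 2) ^ 2 = 1 + lam ^ 2 := Real.sq_sqrt (by positivity)
  ext <;>
  · simp only [dotp, nuv, nupv, Prod.fst_add, Prod.snd_add, Prod.smul_mk, smul_eq_mul]
    field_simp
    rw [h2]; ring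

theorem continuous_dotp (w : Pt2) : Continuous (dotp w) := by
  unfold dotp; fun_prop

theorem isOpen_Qlam (lam : ℝ) : IsOpen (Qlam lam) :=
  (isOpen_lt (continuous_dotp _).abs continuous_const).inter
    (isOpen_lt (continuous_dotp _).abs continuous_const)

/-- Integration in anisotropically rescaled rotated coordinates. -/
theorem lintegral_rot (lam α : ℝ) {δ h : ℝ} (hδ : 0 < δ) (hh : 0 < h) {f : ℝ × ℝ → ℝ≥0∞}
    (hf : Measurable f) :
    ∫⁻ x, f x = ENNReal.ofReal (δ ^ 2 / h) * ∫⁻ P : ℝ, ∫⁻ Q : ℝ,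
      f (α + δ * (P • nuv lam + Q • nupv lam).1, δ / h * (P • nuv lam + Q • nupv lam).2) := by
  have hs := sqrt_one_add_sq_pos lam
  have h2 : Real.sqrt (1 + lam ^ 2) ^ 2 = 1 + lam ^ 2 := Real.sq_sqrt (by positivity)
  have hdet : δ * (1 / Real.sqrt (1 + lam ^ 2)) * (δ / h * (1 / Real.sqrt (1 + lam ^ 2))) -
      (δ * (-lam / Real.sqrt (1 + lam ^ 2))) * (δ / h * (lam / Real.sqrt (1 + lam ^ 2))) =
        δ ^ 2 / h := by
    field_simp
    rw [h2]; ring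
  have hpos : 0 < δ ^ 2 / h := by positivity
  have := lintegral_comp_matrix_add _ _ _ _ (α, 0) (by rw [hdet]; exact hpos.ne') hf
  rw [hdet, abs_of_pos (inv_pos.2 hpos), ENNReal.ofReal_inv_of_pos hpos] at this
  have h0 : ENNReal.ofReal (δ ^ 2 / h) ≠ 0 := by simpa using hpos
  calc ∫⁻ x, f x = ENNReal.ofReal (δ ^ 2 / h) *
        ((ENNReal.ofReal (δ ^ 2 / h))⁻¹ * ∫⁻ x, f x) := by
        rw [← mul_assoc, ENNReal.mul_inv_cancel h0 ENNReal.ofReal_ne_top, one_mul]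
    _ = _ := by
        rw [← this, Measure.volume_eq_prod, lintegral_prod _ (by fun_prop)]
        congr 1
        refine lintegral_congr fun P => lintegral_congr fun Q => congrArg f ?_
        simp only [nuv, nupv, Prod.fst_add, Prod.snd_add, Prod.smul_mk, smul_eq_mul]
        ext <;> simp only <;> ring

/-- The integral over the rotated unit square in rotated coordinates. -/
theorem setLIntegral_Qlam (lam : ℝ) {g : Pt2 → ℝ≥0∞} (hg : Measurable g) :
    ∫⁻ y in Qlam lam, g y = ∫⁻ P in Ioo (-(1 / 2) : ℝ) (1 / 2),
      ∫⁻ Q in Ioo (-(1 / 2) : ℝ) (1 / 2), g (P • nuv lam + Q • nupv lam) := by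
  have hQ := (isOpen_Qlam lam).measurableSet
  rw [← lintegral_indicator hQ,
    lintegral_rot lam 0 one_pos one_pos (hg.indicator hQ), ← lintegral_indicator measurableSet_Ioo]
  simp only [one_pow, div_one, ENNReal.ofReal_one, one_mul, zero_add]
  refine lintegral_congr fun P => ?_
  by_cases hP : P ∈ Ioo (-(1 / 2) : ℝ) (1 / 2)
  · rw [indicator_of_mem hP, ← lintegral_indicator measurableSet_Ioo]
    refine lintegral_congr fun Q => ?_
    have : P • nuv lam + Q • nupv lam ∈ Qlam lam ↔ Q ∈ Ioo (-(1 / 2) : ℝ) (1 / 2) := by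
      simp only [Qlam, mem_ofPred_eq, dotp_nuv_rot, dotp_nupv_rot, abs_lt, mem_Ioo]
      exact ⟨fun h => h.2, fun h => ⟨hP, h⟩⟩
    simp only [indicator, this]
  · rw [indicator_of_notMem hP]
    refine (lintegral_congr fun Q => ?_).trans lintegral_zero
    refine indicator_of_notMem (fun h => hP ?_) _
    have := h.1
    rwa [dotp_nuv_rot, abs_lt] at this

/-- Integral over a long thin slab of a periodic density concentrated on a strip. -/
theorem lintegral_slab_le (lam α : ℝ) {δ h : ℝ} (hδ : 0 < δ) (hh : 0 < h) {g : Pt2 → ℝ≥0∞}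
    (hg : Measurable g) (hper : ∀ y, g (y + nupv lam) = g y)
    (hsupp : ∀ y, 1 / 2 ≤ |dotp (nuv lam) y| → g y = 0) :
    ∫⁻ x : ℝ × ℝ, II.indicator (fun t => g ((x.1 - α) / δ, h * t / δ)) x.2 ≤
      ENNReal.ofReal (δ ^ 2 / h) * (ENNReal.ofReal (Real.sqrt (1 + lam ^ 2) * h / δ + 1) *
        ∫⁻ y in Qlam lam, g y) := by
  have hs := sqrt_one_add_sq_pos lam
  have hm : Measurable fun x : ℝ × ℝ =>
      II.indicator (fun t => g ((x.1 - α) / δ, h * t / δ)) x.2 := by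
    have : Measurable ({x : ℝ × ℝ | x.2 ∈ II}.indicator
        fun x : ℝ × ℝ => g ((x.1 - α) / δ, h * x.2 / δ)) :=
      (hg.comp (by fun_prop)).indicator (measurable_snd measurableSet_Ioo)
    exact this
  rw [lintegral_rot lam α hδ hh hm, setLIntegral_Qlam lam hg,
    ← lintegral_const_mul' (ENNReal.ofReal (Real.sqrt (1 + lam ^ 2) * h / δ + 1)) _
      ENNReal.ofReal_ne_top, ← lintegral_indicator measurableSet_Ioo]
  gcongr with P
  by_cases hP : P ∈ Ioo (-(1 / 2) : ℝ) (1 / 2)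
  · rw [indicator_of_mem hP]
    have hperQ : Function.Periodic (fun Q : ℝ => g (P • nuv lam + Q • nupv lam)) 1 := fun Q => by
      simp only [add_smul, one_smul, ← add_assoc, hper]
    have := hperQ.setLIntegral_Ioo_le (-lam * P - (Real.sqrt (1 + lam ^ 2) * h / δ) / 2) (-(1 / 2))
      (Real.sqrt (1 + lam ^ 2) * h / δ) (by positivity)
    rw [show (-(1 / 2) + 1 : ℝ) = 1 / 2 by norm_num] at this
    refine le_trans ?_ this
    rw [← lintegral_indicator measurableSet_Ioo]
    refine lintegral_mono fun Q => ?_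
    dsimp only
    set y := P • nuv lam + Q • nupv lam with hy
    by_cases hmem : δ / h * y.2 ∈ II
    · rw [indicator_of_mem hmem, indicator_of_mem]
      · apply le_of_eq
        congr 1
        ext <;> (simp only; field_simp; ring)
      · have e : y.2 = (lam * P + Q) / Real.sqrt (1 + lam ^ 2) := by
          simp only [hy, nuv, nupv, Prod.snd_add, Prod.smul_mk, smul_eq_mul]; ring
        rw [e] at hmem
        obtain ⟨h1, h2⟩ := hmem
        have e2 : δ / h * ((lam * P + Q) / Real.sqrt (1 + lam ^ 2)) =
          (lam * P + Q) / (Real.sqrt (1 + lam ^ 2) * h / δ) := by field_simp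
        have hR : 0 < Real.sqrt (1 + lam ^ 2) * h / δ := by positivity
        rw [e2, lt_div_iff₀ hR] at h1
        rw [e2, div_lt_iff₀ hR] at h2
        constructor <;> linarith
    · rw [indicator_of_notMem hmem]
      exact zero_le
  · rw [indicator_of_notMem hP, nonpos_iff_eq_zero]
    refine (lintegral_congr fun Q => ?_).trans lintegral_zero
    have hz : g (P • nuv lam + Q • nupv lam) = 0 := by
      apply hsupp
      rw [dotp_nuv_rot]
      by_contra hc
      exact hP (abs_lt.1 (not_le.1 hc))
    apply indicator_apply_eq_zero.2
    intro _
    convert hz using 1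
    congr 1
    ext
    · simp only
      field_simp
      ring
    · simp only
      field_simp

theorem isOpen_Om {ω : Set (ℝ × ℝ)} (hω : IsOpen ω) : IsOpen (Om ω) := by
  have h1 : Continuous fun x : Pt => (x.1, x.2.1) := by fun_prop
  have h2 : Continuous fun x : Pt => x.2.2 := by fun_prop
  exact (hω.preimage h1).inter (isOpen_Ioo.preimage h2)

/-- Integral over the thin domain of a periodic density concentrated on a layer. -/
theorem lintegral_layer_le {ω : Set (ℝ × ℝ)} (hω : IsOpen ω) (lam α : ℝ) {δ h r : ℝ}
    (hδ : 0 < δ) (hh : 0 < h) {c : ℝ≥0∞} (hc : c ≠ ⊤)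
    (hslice : ∀ x : ℝ, |x - α| < r → volume {t : ℝ | (x, t) ∈ ω} ≤ c)
    (hr : Real.sqrt (1 + lam ^ 2) * δ / 2 + |lam| * h / 2 ≤ r) {g : Pt2 → ℝ≥0∞}
    (hg : Measurable g) (hper : ∀ y, g (y + nupv lam) = g y)
    (hsupp : ∀ y, 1 / 2 ≤ |dotp (nuv lam) y| → g y = 0) :
    ∫⁻ x in Om ω, g ((x.1 - α) / δ, h * x.2.2 / δ) ≤
      c * (ENNReal.ofReal (δ ^ 2 / h) * (ENNReal.ofReal (Real.sqrt (1 + lam ^ 2) * h / δ + 1) *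
        ∫⁻ y in Qlam lam, g y)) := by
  have hs := sqrt_one_add_sq_pos lam
  have hslice_meas : ∀ x : ℝ, MeasurableSet {t : ℝ | (x, t) ∈ ω} := fun x =>
    (hω.preimage (by fun_prop : Continuous fun t : ℝ => (x, t))).measurableSet
  have hm : Measurable fun x : ℝ × ℝ =>
      II.indicator (fun t => g ((x.1 - α) / δ, h * t / δ)) x.2 := by
    have : Measurable ({x : ℝ × ℝ | x.2 ∈ II}.indicator
        fun x : ℝ × ℝ => g ((x.1 - α) / δ, h * x.2 / δ)) :=
      (hg.comp (by fun_prop)).indicator (measurable_snd measurableSet_Ioo)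
    exact this
  refine le_trans ?_ (mul_le_mul_right (lintegral_slab_le lam α hδ hh hg hper hsupp) c)
  rw [← lintegral_indicator (isOpen_Om hω).measurableSet, Measure.volume_eq_prod ℝ ℝ,
    lintegral_prod _ hm.aemeasurable, ← lintegral_const_mul' _ _ hc]
  refine (lintegral_prod_le _).trans (lintegral_mono fun x => ?_)
  dsimp only
  calc ∫⁻ y : ℝ × ℝ, (Om ω).indicator (fun x : Pt => g ((x.1 - α) / δ, h * x.2.2 / δ)) (x, y)
      = ∫⁻ y : ℝ × ℝ, {t : ℝ | (x, t) ∈ ω}.indicator 1 y.1 *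
          II.indicator (fun t => g ((x - α) / δ, h * t / δ)) y.2 := by
        refine lintegral_congr fun y => ?_
        simp only [Om, indicator, mem_ofPred_eq, Pi.one_apply]
        by_cases h1 : (x, y.1) ∈ ω <;> by_cases h2 : y.2 ∈ II <;> simp [h1, h2]
    _ = volume {t : ℝ | (x, t) ∈ ω} *
          ∫⁻ t, II.indicator (fun t => g ((x - α) / δ, h * t / δ)) t := by
        rw [Measure.volume_eq_prod, lintegral_prod_mul, lintegral_indicator_one (hslice_meas x)]
        · exact (measurable_one.indicator (hslice_meas x)).aemeasurable
        · exact (hm.comp (by fun_prop : Measurable fun t : ℝ => (x, t))).aemeasurable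
    _ ≤ c * ∫⁻ t, II.indicator (fun t => g ((x - α) / δ, h * t / δ)) t := by
        by_cases hx : |x - α| < r
        · gcongr
          exact hslice x hx
        · have : ∫⁻ t, II.indicator (fun t => g ((x - α) / δ, h * t / δ)) t = 0 := by
            refine (lintegral_congr fun t => ?_).trans lintegral_zero
            refine indicator_apply_eq_zero.2 fun ht => hsupp _ ?_
            rw [dotp_nuv]
            by_contra hcon
            apply hx
            rw [not_le, abs_div, abs_of_pos hs, div_lt_iff₀ hs] at hcon
            have e : (x - α) / δ + lam * (h * t / δ) = (x - α + lam * h * t) / δ := by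
              field_simp
            simp only at hcon
            rw [e, abs_div, abs_of_pos hδ, div_lt_iff₀ hδ] at hcon
            have ht' : |t| < 1 / 2 := abs_lt.2 ht
            have e3 : |lam * h * t| ≤ |lam| * h / 2 := by
              rw [abs_mul, abs_mul, abs_of_pos hh]
              have := mul_le_mul_of_nonneg_left ht'.le (mul_nonneg (abs_nonneg lam) hh.le)
              linarith
            have e4 : |x - α| ≤ |x - α + lam * h * t| + |lam * h * t| := by
              have := abs_sub (x - α + lam * h * t) (lam * h * t)
              simpa using this
            linarith
          rw [this]; simp

end

/-- The linear map `y ↦ (y₁ + λ y₂) a`, whose gradient is the planar part of the well. -/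
noncomputable def wellMap (a : V3) (lam : ℝ) : Pt2 →L[ℝ] V3 :=
  (ContinuousLinearMap.fst ℝ ℝ ℝ + lam • ContinuousLinearMap.snd ℝ ℝ ℝ).smulRight a

theorem wellMap_apply (a : V3) (lam : ℝ) (y : Pt2) :
    wellMap a lam y = (y.1 + lam * y.2) • a := by
  simp [wellMap]

theorem wellMap_f1 (a : V3) (lam : ℝ) : wellMap a lam f1 = a := by
  simp [wellMap_apply, f1]

theorem wellMap_f2 (a : V3) (lam : ℝ) : wellMap a lam f2 = lam • a := by
  simp [wellMap_apply, f2]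

theorem wellMap_nupv (a : V3) (lam : ℝ) : wellMap a lam (nupv lam) = 0 := by
  rw [wellMap_apply]
  have : (nupv lam).1 + lam * (nupv lam).2 = 0 := by simp only [nupv]; ring
  rw [this, zero_smul]

theorem clm_ext_f1_f2 {T S : Pt2 →L[ℝ] V3} (h1 : T f1 = S f1) (h2 : T f2 = S f2) : T = S := by
  refine ContinuousLinearMap.ext fun y => ?_
  have : y = y.1 • f1 + y.2 • f2 := by ext <;> simp [f1, f2]
  rw [this, map_add, map_add, map_smul, map_smul, map_smul, map_smul, h1, h2]

/-- The planar density of a profile `G`, measured relative to the well `-τ A`. -/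
noncomputable def cellDensity (W : M33 → ℝ) (a : V3) (lam τ ℓ : ℝ) (G : Pt2 → V3) (y : Pt2) : ℝ :=
  ℓ * W ![qd f1 G y + τ • a, 0, qd f2 G y + τ • (lam • a)] + ℓ⁻¹ * hess2d G y

/-- A transition profile: it vanishes on one side of the rotated cell and has gradient equal to
`-2 τ (a, λ a)` on the other. -/
structure IsProfile (a : V3) (lam τ : ℝ) (G : Pt2 → V3) : Prop where
  contDiff : ContDiff ℝ 2 G
  periodic : ∀ y, G (y + nupv lam) = G y
  left : ∃ η > (0 : ℝ), ∀ y, dotp (nuv lam) y < -(1 / 2) + η → G y = 0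
  right : ∃ η > (0 : ℝ), ∃ k : V3, ∀ y, 1 / 2 - η < dotp (nuv lam) y →
    G y = -(2 * τ) • wellMap a lam y + k

theorem hess2d_congr {G v : Pt2 → V3} {y : Pt2} (w : Pt2 → V3)
    (h : ∀ e, qd e G =ᶠ[𝓝 y] fun z => qd e v z + w e) : hess2d G y = hess2d v y := by
  have : ∀ e e', qd e' (qd e G) y = qd e' (qd e v) y := fun e e' => by
    unfold qd
    have := (h e).fderiv_eq (𝕜 := ℝ)
    rw [fderiv_add_const] at this
    exact congrArg (fun T => T e') this
  simp only [hess2d, this]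

theorem qd_eventuallyEq {G v : Pt2 → V3} {y : Pt2} {T : Pt2 →L[ℝ] V3} {k : V3}
    (hv : Differentiable ℝ v) (h : G =ᶠ[𝓝 y] fun z => v z + T z + k) (e : Pt2) :
    qd e G =ᶠ[𝓝 y] fun z => qd e v z + T e := by
  filter_upwards [h.fderiv (𝕜 := ℝ)] with z hz
  rw [qd, hz, fderiv_add_const, fderiv_fun_add (hv z) T.differentiableAt, T.fderiv]
  rfl

theorem continuous_qd {G : Pt2 → V3} (hG : ContDiff ℝ 1 G) (e : Pt2) : Continuous (qd e G) :=
  (hG.continuous_fderiv one_ne_zero).clm_apply continuous_const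

theorem contDiff_qd {G : Pt2 → V3} (hG : ContDiff ℝ 2 G) (e : Pt2) : ContDiff ℝ 1 (qd e G) :=
  (hG.fderiv_right (m := 1) (by norm_num)).clm_apply contDiff_const

theorem continuous_vnorm : Continuous vnorm := by
  unfold vnorm; fun_prop

theorem vnorm_neg (v : V3) : vnorm (-v) = vnorm v := by simp [vnorm]

theorem vnorm_zero : vnorm 0 = 0 := by simp [vnorm]

theorem vnorm_nonneg (v : V3) : 0 ≤ vnorm v := Real.sqrt_nonneg _

theorem vnorm_le (v : V3) : vnorm v ≤ 2 * ‖v‖ := by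
  rw [vnorm, Real.sqrt_le_left (by positivity), Fin.sum_univ_three]
  have h : ∀ i, (v i) ^ 2 ≤ ‖v‖ ^ 2 := fun i => sq_le_sq.2 (by
    rw [abs_of_nonneg (norm_nonneg v)]; exact norm_le_pi_norm v i)
  nlinarith [h 0, h 1, h 2, sq_nonneg ‖v‖]

theorem vnorm_smul (c : ℝ) (v : V3) : vnorm (c • v) = |c| * vnorm v := by
  simp only [vnorm, Pi.smul_apply, smul_eq_mul, mul_pow, ← Finset.mul_sum]
  rw [Real.sqrt_mul (sq_nonneg c), Real.sqrt_sq_eq_abs]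

theorem hess2d_nonneg (G : Pt2 → V3) (y : Pt2) : 0 ≤ hess2d G y := by
  unfold hess2d; positivity

theorem continuous_hess2d {G : Pt2 → V3} (hG : ContDiff ℝ 2 G) : Continuous (hess2d G) := by
  have h : ∀ e e', Continuous fun y => vnorm (qd e' (qd e G) y) ^ 2 := fun e e' =>
    (continuous_vnorm.comp (continuous_qd (contDiff_qd hG e) e')).pow 2
  unfold hess2d
  exact ((h _ _).add (continuous_const.mul (h _ _))).add (h _ _)

theorem continuous_cellDensity {W : M33 → ℝ} (hW : Continuous W) (a : V3) (lam τ ℓ : ℝ)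
    {G : Pt2 → V3} (hG : ContDiff ℝ 2 G) : Continuous (cellDensity W a lam τ ℓ G) := by
  have h : ∀ e, Continuous (qd e G) := continuous_qd (hG.of_le (by norm_num))
  refine (continuous_const.mul (hW.comp (continuous_pi fun j => ?_))).add
    (continuous_const.mul (continuous_hess2d hG))
  fin_cases j
  · exact (h f1).add continuous_const
  · exact continuous_const
  · exact (h f2).add continuous_const

theorem cellDensity_nonneg {W : M33 → ℝ} (hW : ∀ ξ, 0 ≤ W ξ) (a : V3) (lam τ : ℝ) {ℓ : ℝ}
    (hℓ : 0 < ℓ) (G : Pt2 → V3) (y : Pt2) : 0 ≤ cellDensity W a lam τ ℓ G y :=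
  add_nonneg (mul_nonneg hℓ.le (hW _)) (mul_nonneg (inv_pos.2 hℓ).le (hess2d_nonneg _ _))

/-- The plane waves interpolating smoothly between the wells are competitors. -/
theorem exists_competitor (a : V3) (lam : ℝ) : ∃ v : Pt2 → V3,
    ContDiff ℝ 2 v ∧ (∀ y : Pt2, v (y + nupv lam) = v y) ∧
      (∃ δ > (0 : ℝ), ∀ y : Pt2, |dotp (nuv lam) y - 1 / 2| < δ →
        qd f1 v y = a ∧ qd f2 v y = lam • a) ∧
      (∃ δ > (0 : ℝ), ∀ y : Pt2, |dotp (nuv lam) y + 1 / 2| < δ →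
        qd f1 v y = -a ∧ qd f2 v y = -(lam • a)) := by
  have hdc : ContDiff ℝ 2 fun y : Pt2 => dotp (nuv lam) y := by unfold dotp; fun_prop
  refine ⟨fun y => (2 * Real.smoothTransition (2 * dotp (nuv lam) y + 1 / 2) - 1) • wellMap a lam y,
    ?_, fun y => ?_, ⟨1 / 4, by norm_num, fun y hy => ?_⟩, ⟨1 / 4, by norm_num, fun y hy => ?_⟩⟩
  · have : ContDiff ℝ 2 fun y : Pt2 =>
        2 * Real.smoothTransition (2 * dotp (nuv lam) y + 1 / 2) - 1 := (contDiff_const.mul (Real.smoothTransition.contDiff.comp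
      ((contDiff_const.mul hdc).add contDiff_const))).sub contDiff_const
    exact this.smul (wellMap a lam).contDiff
  · simp only [dotp_nuv_add_nupv, map_add, wellMap_nupv, add_zero]
  · have : (fun y => (2 * Real.smoothTransition (2 * dotp (nuv lam) y + 1 / 2) - 1) •
        wellMap a lam y) =ᶠ[𝓝 y] wellMap a lam := by
      filter_upwards [(isOpen_lt ((continuous_dotp (nuv lam)).sub continuous_const).abs
        continuous_const).mem_nhds hy] with z hz
      have := (abs_lt.1 hz).1
      simp only [Pi.sub_apply] at this
      rw [Real.smoothTransition.one_of_one_le (by linarith)]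
      norm_num
    rw [qd, qd, this.fderiv_eq, ContinuousLinearMap.fderiv, wellMap_f1, wellMap_f2]
    exact ⟨rfl, rfl⟩
  · have : (fun y => (2 * Real.smoothTransition (2 * dotp (nuv lam) y + 1 / 2) - 1) •
        wellMap a lam y) =ᶠ[𝓝 y] ⇑(-wellMap a lam) := by
      filter_upwards [(isOpen_lt ((continuous_dotp (nuv lam)).add continuous_const).abs
        continuous_const).mem_nhds hy] with z hz
      have := (abs_lt.1 hz).2
      simp only [Pi.add_apply] at this
      rw [Real.smoothTransition.zero_of_nonpos (by linarith)]
      simp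
    rw [qd, qd, this.fderiv_eq, ContinuousLinearMap.fderiv]
    simp [wellMap_f1, wellMap_f2]

theorem eq_add_const_of_strip {v : Pt2 → V3} (hv : Differentiable ℝ v) (T : Pt2 →L[ℝ] V3)
    (lam c δ : ℝ)
    (h : ∀ y : Pt2, |dotp (nuv lam) y - c| < δ → qd f1 v y = T f1 ∧ qd f2 v y = T f2) :
    ∃ k : V3, ∀ y, |dotp (nuv lam) y - c| < δ → v y = T y + k := by
  set U : Set Pt2 := {y | |dotp (nuv lam) y - c| < δ} with hU
  have hUo : IsOpen U := isOpen_lt ((continuous_dotp _).sub continuous_const).abs continuous_const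
  have hconv : Convex ℝ U := by
    intro x hx y hy s t hs ht hst
    simp only [hU, mem_ofPred_eq, abs_lt] at hx hy ⊢
    have e : dotp (nuv lam) (s • x + t • y) - c =
        s * (dotp (nuv lam) x - c) + t * (dotp (nuv lam) y - c) := by
      simp only [dotp, Prod.fst_add, Prod.snd_add, Prod.smul_fst, Prod.smul_snd, smul_eq_mul]
      linear_combination c * hst
    rw [e]
    have ht' : t = 1 - s := by linarith
    subst ht'
    constructor
    · rcases hs.eq_or_lt with rfl | hs'
      · linarith
      · nlinarith [mul_lt_mul_of_pos_left hx.1 hs', mul_le_mul_of_nonneg_left hy.1.le ht]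
    · rcases hs.eq_or_lt with rfl | hs'
      · linarith
      · nlinarith [mul_lt_mul_of_pos_left hx.2 hs', mul_le_mul_of_nonneg_left hy.2.le ht]
  obtain ⟨k, hk⟩ := hUo.exists_is_const_of_fderiv_eq_zero (f := fun y => v y - T y)
    hconv.isPreconnected (hv.sub T.differentiable).differentiableOn (fun y hy => by
      rw [fderiv_fun_sub (hv y) T.differentiableAt, T.fderiv]
      exact sub_eq_zero.2 (clm_ext_f1_f2 (h y hy).1 (h y hy).2))
  exact ⟨k, fun y hy => by rw [← hk y hy]; simp⟩

/-- A competitor of the cell problem, normalized on one side, extends to a transition profile. -/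
theorem exists_profile_of_competitor (a : V3) (lam : ℝ) {v : Pt2 → V3} (hv : ContDiff ℝ 2 v)
    (hper : ∀ y : Pt2, v (y + nupv lam) = v y)
    (hR : ∃ δ > (0 : ℝ), ∀ y : Pt2, |dotp (nuv lam) y - 1 / 2| < δ →
      qd f1 v y = a ∧ qd f2 v y = lam • a)
    (hL : ∃ δ > (0 : ℝ), ∀ y : Pt2, |dotp (nuv lam) y + 1 / 2| < δ →
      qd f1 v y = -a ∧ qd f2 v y = -(lam • a)) :
    ∃ G : Pt2 → V3, IsProfile a lam (-1) G ∧ ∀ (W : M33 → ℝ) (ℓ : ℝ), ∀ y ∈ Qlam lam,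
      cellDensity W a lam (-1) ℓ G y = ℓ * W2 W v y + ℓ⁻¹ * hess2d v y := by
  obtain ⟨δR, hδR, hR⟩ := hR
  obtain ⟨δL, hδL, hL⟩ := hL
  have hvd : Differentiable ℝ v := hv.differentiable (by norm_num)
  obtain ⟨kR, hkR⟩ := eq_add_const_of_strip hvd (wellMap a lam) lam (1 / 2) δR
    (fun y hy => by rw [wellMap_f1, wellMap_f2]; exact hR y hy)
  obtain ⟨kL, hkL⟩ := eq_add_const_of_strip hvd (-wellMap a lam) lam (-(1 / 2)) δL
    (fun y hy => by
      rw [sub_neg_eq_add] at hy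
      simpa [wellMap_f1, wellMap_f2] using hL y hy)
  set G : Pt2 → V3 := fun y =>
    if dotp (nuv lam) y < -(1 / 2) then 0
    else if 1 / 2 < dotp (nuv lam) y then (2 : ℝ) • wellMap a lam y + (kR - kL)
    else v y + wellMap a lam y + -kL with hG
  have hGL : ∀ y, dotp (nuv lam) y < -(1 / 2) + min δL 1 → G y = 0 := by
    intro y hy
    have hm1 := min_le_left δL 1
    have hm2 := min_le_right δL 1
    simp only [hG]
    split_ifs with h1 h2
    · rfl
    · linarith
    · have := hkL y (abs_lt.2 ⟨by linarith, by linarith⟩)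
      rw [this]
      simp
  have hGR : ∀ y, 1 / 2 - min δR 1 < dotp (nuv lam) y →
      G y = (2 : ℝ) • wellMap a lam y + (kR - kL) := by
    intro y hy
    have hm1 := min_le_left δR 1
    have hm2 := min_le_right δR 1
    simp only [hG]
    split_ifs with h1 h2
    · linarith
    · rfl
    · rw [hkR y (abs_lt.2 ⟨by linarith, by linarith⟩)]
      module
  have hGM : ∀ y, |dotp (nuv lam) y| < 1 / 2 →
      G =ᶠ[𝓝 y] fun z => v z + wellMap a lam z + -kL := by
    intro y hy
    filter_upwards [(isOpen_lt (continuous_dotp (nuv lam)).abs continuous_const).mem_nhds hy]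
      with z hz
    have := abs_lt.1 hz
    simp only [hG]
    rw [if_neg (by linarith), if_neg (by linarith)]
  have hLpos : 0 < min δL 1 := lt_min hδL one_pos
  have hRpos : 0 < min δR 1 := lt_min hδR one_pos
  refine ⟨G, ⟨contDiff_iff_contDiffAt.2 fun y => ?_, fun y => ?_, ⟨_, hLpos, hGL⟩,
    ⟨_, hRpos, kR - kL, fun y hy => ?_⟩⟩, fun W ℓ y hy => ?_⟩
  · by_cases h1 : dotp (nuv lam) y < -(1 / 2) + min δL 1
    · have : G =ᶠ[𝓝 y] fun _ => 0 := by
        filter_upwards [(isOpen_lt (continuous_dotp (nuv lam)) continuous_const).mem_nhds h1]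
          with z hz using hGL z hz
      exact contDiffAt_const.congr_of_eventuallyEq this
    · by_cases h2 : 1 / 2 - min δR 1 < dotp (nuv lam) y
      · have : G =ᶠ[𝓝 y] fun z => (2 : ℝ) • wellMap a lam z + (kR - kL) := by
          filter_upwards [(isOpen_lt continuous_const (continuous_dotp (nuv lam))).mem_nhds h2]
            with z hz using hGR z hz
        refine ContDiffAt.congr_of_eventuallyEq ?_ this
        exact ((contDiff_const_smul 2).comp (wellMap a lam).contDiff).contDiffAt.add
          contDiffAt_const
      · refine ContDiffAt.congr_of_eventuallyEq ?_ (hGM y (abs_lt.2 ⟨by linarith, by linarith⟩))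
        exact (hv.contDiffAt.add (wellMap a lam).contDiff.contDiffAt).add contDiffAt_const
  · simp only [hG, dotp_nuv_add_nupv, map_add, wellMap_nupv, add_zero, hper]
  · rw [hGR y hy]; norm_num
  · have hq := fun e => qd_eventuallyEq hvd (hGM y hy.1) e
    rw [cellDensity, hess2d_congr _ hq, W2, (hq f1).self_of_nhds, (hq f2).self_of_nhds,
      wellMap_f1, wellMap_f2]
    simp

theorem qd_comp_neg {G : Pt2 → V3} (hG : Differentiable ℝ G) (e y : Pt2) :
    qd e (fun z => G (-z)) y = -qd e G (-y) := by
  have := ((hG (-y)).hasFDerivAt.comp y (hasFDerivAt_id y).neg).fderiv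
  unfold qd
  rw [show (fun z => G (-z)) = G ∘ fun z => -z from rfl]
  erw [this]
  simp

/-- Point reflection exchanges the two kinds of transition profiles. -/
theorem IsProfile.reflect {a : V3} {lam : ℝ} {G : Pt2 → V3} (hP : IsProfile a lam (-1) G) :
    ∃ G' : Pt2 → V3, IsProfile a lam 1 G' ∧ ∀ (W : M33 → ℝ) (ℓ : ℝ) (y : Pt2),
      cellDensity W a lam 1 ℓ G' y = cellDensity W a lam (-1) ℓ G (-y) := by
  obtain ⟨ηL, hηL, hL⟩ := hP.left
  obtain ⟨ηR, hηR, k, hR⟩ := hP.right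
  have hGd : Differentiable ℝ G := hP.contDiff.differentiable (by norm_num)
  have hneg : ∀ y, dotp (nuv lam) (-y) = -dotp (nuv lam) y := fun y => by
    simp only [dotp, Prod.fst_neg, Prod.snd_neg]; ring
  set N : Pt2 → V3 := fun z => -G (-z) with hN
  have hNc : ContDiff ℝ 2 N := (hP.contDiff.comp contDiff_neg).neg
  have hNd : Differentiable ℝ N := hNc.differentiable (by norm_num)
  have hqN : ∀ e, qd e N = fun z => qd e G (-z) := fun e => by
    funext z
    have : qd e N z = -qd e (fun z => G (-z)) z := by
      unfold qd
      rw [hN, fderiv_fun_neg]; rfl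
    rw [this, qd_comp_neg hGd, neg_neg]
  have hqqN : ∀ e e' z, qd e' (qd e N) z = -qd e' (qd e G) (-z) := fun e e' z => by
    rw [hqN, qd_comp_neg ((contDiff_qd hP.contDiff e).differentiable (by norm_num))]
  refine ⟨fun z => N z + (-(2 : ℝ) • wellMap a lam) z + k, ⟨?_, fun y => ?_,
    ⟨ηR, hηR, fun y hy => ?_⟩, ⟨ηL, hηL, k, fun y hy => ?_⟩⟩, fun W ℓ y => ?_⟩
  · exact (hNc.add (ContinuousLinearMap.contDiff _)).add contDiff_const
  · have : G (-(y + nupv lam)) = G (-y) := by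
      rw [← hP.periodic (-(y + nupv lam))]; congr 1; abel
    simp only [hN, this, map_add, smul_apply, wellMap_nupv, smul_zero, add_zero]
  · simp only [hN]
    rw [hR (-y) (by rw [hneg]; linarith)]
    simp only [map_neg, smul_apply]
    module
  · simp only [hN]
    rw [hL (-y) (by rw [hneg]; linarith)]
    simp
  · have hq : ∀ e, qd e (fun z => N z + (-(2 : ℝ) • wellMap a lam) z + k) =ᶠ[𝓝 y]
        fun z => qd e N z + (-(2 : ℝ) • wellMap a lam) e := fun e =>
      qd_eventuallyEq hNd (Eventually.of_forall fun z => rfl) e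
    rw [cellDensity, hess2d_congr _ hq, cellDensity, (hq f1).self_of_nhds, (hq f2).self_of_nhds,
      hqN, hqN]
    have hh : hess2d N y = hess2d G (-y) := by
      simp only [hess2d, hqqN, vnorm_neg]
    rw [hh]
    simp only [smul_apply, wellMap_f1, wellMap_f2]
    congr 4
    · module
    · congr 2
      module

theorem exists_bound_of_periodic_strip {E : Type*} [NormedAddCommGroup E] {f : Pt2 → E}
    (lam : ℝ) (hf : Continuous f) (hper : ∀ y, f (y + nupv lam) = f y) (k₁ k₂ : E)
    (h₁ : ∀ y, dotp (nuv lam) y ≤ -(1 / 2) → f y = k₁)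
    (h₂ : ∀ y, 1 / 2 ≤ dotp (nuv lam) y → f y = k₂) : ∃ C : ℝ, ∀ y, ‖f y‖ ≤ C := by
  obtain ⟨C, hC⟩ := (isCompact_Icc.prod isCompact_Icc :
    IsCompact (Icc (-(1 / 2) : ℝ) (1 / 2) ×ˢ Icc (0 : ℝ) 1)).exists_bound_of_continuousOn
      (f := fun z : ℝ × ℝ => f (z.1 • nuv lam + z.2 • nupv lam)) (by fun_prop)
  refine ⟨max C (max ‖k₁‖ ‖k₂‖), fun y => ?_⟩
  by_cases hy1 : dotp (nuv lam) y ≤ -(1 / 2)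
  · rw [h₁ y hy1]; simp
  by_cases hy2 : 1 / 2 ≤ dotp (nuv lam) y
  · rw [h₂ y hy2]; simp
  have hp : Function.Periodic (fun Q : ℝ => f (dotp (nuv lam) y • nuv lam + Q • nupv lam)) 1 :=
    fun Q => by simp only [add_smul, one_smul, ← add_assoc, hper]
  obtain ⟨Q, hQ, hQe⟩ := hp.exists_mem_Ico₀ one_pos (dotp (nupv lam) y)
  rw [rot_dotp] at hQe
  rw [hQe]
  exact (hC (dotp (nuv lam) y, Q) ⟨⟨by linarith, by linarith⟩, ⟨hQ.1, hQ.2.le⟩⟩).trans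
    (le_max_left _ _)

namespace IsProfile

variable {a : V3} {lam τ : ℝ} {G : Pt2 → V3}

theorem fderiv_left (hP : IsProfile a lam τ G) {y : Pt2} (hy : dotp (nuv lam) y ≤ -(1 / 2)) :
    fderiv ℝ G =ᶠ[𝓝 y] fun _ => 0 := by
  obtain ⟨η, hη, h⟩ := hP.left
  have hy' : dotp (nuv lam) y < -(1 / 2) + η := by linarith
  have : G =ᶠ[𝓝 y] fun _ => 0 := by
    filter_upwards [(isOpen_lt (continuous_dotp (nuv lam)) continuous_const).mem_nhds hy']
      with z hz using h z hz
  filter_upwards [this.fderiv (𝕜 := ℝ)] with z hz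
  rw [hz]; simp

theorem fderiv_right (hP : IsProfile a lam τ G) {y : Pt2} (hy : 1 / 2 ≤ dotp (nuv lam) y) :
    fderiv ℝ G =ᶠ[𝓝 y] fun _ => -(2 * τ) • wellMap a lam := by
  obtain ⟨η, hη, k, h⟩ := hP.right
  have hy' : 1 / 2 - η < dotp (nuv lam) y := by linarith
  have : G =ᶠ[𝓝 y] fun z => (-(2 * τ) • wellMap a lam) z + k := by
    filter_upwards [(isOpen_lt continuous_const (continuous_dotp (nuv lam))).mem_nhds hy']
      with z hz using h z hz
  filter_upwards [this.fderiv (𝕜 := ℝ)] with z hz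
  rw [hz, fderiv_add_const, ContinuousLinearMap.fderiv]

theorem qd_qd_eq_zero (hP : IsProfile a lam τ G) {y : Pt2} (hy : 1 / 2 ≤ |dotp (nuv lam) y|)
    (e e' : Pt2) : qd e' (qd e G) y = 0 := by
  rcases le_abs.1 hy with h | h
  · have : qd e G =ᶠ[𝓝 y] fun _ => (-(2 * τ) • wellMap a lam) e := by
      filter_upwards [hP.fderiv_right h] with z hz
      rw [qd, hz]
    rw [qd, this.fderiv_eq]; simp
  · have : qd e G =ᶠ[𝓝 y] fun _ => 0 := by
      filter_upwards [hP.fderiv_left (by linarith : dotp (nuv lam) y ≤ -(1 / 2))] with z hz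
      rw [qd, hz]; rfl
    rw [qd, this.fderiv_eq]; simp

theorem fderiv_periodic (hP : IsProfile a lam τ G) (y : Pt2) :
    fderiv ℝ G (y + nupv lam) = fderiv ℝ G y := by
  have := fderiv_comp_add_right (𝕜 := ℝ) (f := G) (x := y) (nupv lam)
  rw [← this]
  simp only [hP.periodic]

theorem qd_qd_periodic (hP : IsProfile a lam τ G) (e e' y : Pt2) :
    qd e' (qd e G) (y + nupv lam) = qd e' (qd e G) y := by
  have := fderiv_comp_add_right (𝕜 := ℝ) (f := qd e G) (x := y) (nupv lam)
  unfold qd at *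
  rw [← this]
  simp only [hP.fderiv_periodic]

theorem cellDensity_periodic (hP : IsProfile a lam τ G) (W : M33 → ℝ) (ℓ : ℝ) (y : Pt2) :
    cellDensity W a lam τ ℓ G (y + nupv lam) = cellDensity W a lam τ ℓ G y := by
  simp only [cellDensity, hess2d, hP.qd_qd_periodic]
  simp only [qd, hP.fderiv_periodic]

theorem cellDensity_eq_zero (hP : IsProfile a lam τ G) {W : M33 → ℝ} (hτ : τ = 1 ∨ τ = -1)
    (hWp : W ![a, 0, lam • a] = 0) (hWm : W ![-a, 0, -(lam • a)] = 0) (ℓ : ℝ) {y : Pt2}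
    (hy : 1 / 2 ≤ |dotp (nuv lam) y|) : cellDensity W a lam τ ℓ G y = 0 := by
  simp only [cellDensity, hess2d, hP.qd_qd_eq_zero hy, vnorm_zero]
  have : W ![qd f1 G y + τ • a, 0, qd f2 G y + τ • lam • a] = 0 := by
    rcases le_abs.1 hy with h | h
    · have h1 := (hP.fderiv_right h).self_of_nhds
      simp only [qd, h1, smul_apply, wellMap_f1, wellMap_f2]
      have e : ∀ w : V3, -(2 * τ) • w + τ • w = -(τ • w) := fun w => by module
      rw [e, e]
      rcases hτ with rfl | rfl <;> simpa
    · have h1 := (hP.fderiv_left (by linarith : dotp (nuv lam) y ≤ -(1 / 2))).self_of_nhds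
      simp only [qd, h1, zero_apply, zero_add]
      rcases hτ with rfl | rfl <;> simpa
  rw [this]; simp

theorem exists_bound_fderiv (hP : IsProfile a lam τ G) : ∃ C : ℝ, ∀ y, ‖fderiv ℝ G y‖ ≤ C :=
  exists_bound_of_periodic_strip lam (hP.contDiff.continuous_fderiv (by norm_num))
    hP.fderiv_periodic _ _ (fun _ hy => (hP.fderiv_left hy).self_of_nhds)
    (fun _ hy => (hP.fderiv_right hy).self_of_nhds)

theorem exists_bound_sub (hP : IsProfile a lam τ G) :
    ∃ C : ℝ, ∀ y : Pt2, ‖G y + (2 * τ * max (y.1 + lam * y.2) 0) • a‖ ≤ C := by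
  obtain ⟨ηL, hηL, hL⟩ := hP.left
  obtain ⟨ηR, hηR, k, hR⟩ := hP.right
  have hs := sqrt_one_add_sq_pos lam
  refine exists_bound_of_periodic_strip lam ?_ (fun y => ?_) 0 k (fun y hy => ?_) (fun y hy => ?_)
  · have := hP.contDiff.continuous
    fun_prop
  · rw [hP.periodic]
    have : (y + nupv lam).1 + lam * (y + nupv lam).2 = y.1 + lam * y.2 := by
      simp only [nupv, Prod.fst_add, Prod.snd_add]; ring
    rw [this]
  · rw [hL y (by linarith)]
    rw [dotp_nuv, div_le_iff₀ hs] at hy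
    rw [max_eq_right (by linarith)]; simp
  · rw [hR y (by linarith)]
    rw [dotp_nuv, le_div_iff₀ hs] at hy
    rw [max_eq_left (by linarith), wellMap_apply]
    module

end IsProfile

theorem Fin.lt_card_filter_iff {m : ℕ} (R : Fin m → Prop) [DecidablePred R]
    (hR : ∀ i j, i ≤ j → R j → R i) (i : Fin m) :
    (i : ℕ) < (Finset.univ.filter R).card ↔ R i := by
  constructor
  · intro h
    by_contra hi
    have : Finset.univ.filter R ⊆ Finset.Iio i := fun j hj => by
      simp only [Finset.mem_filter, Finset.mem_univ, true_and] at hj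
      exact Finset.mem_Iio.2 (not_le.1 fun hij => hi (hR i j hij hj))
    have := Finset.card_le_card this
    rw [Fin.card_Iio] at this
    omega
  · intro h
    have : Finset.Iic i ⊆ Finset.univ.filter R := fun j hj => by
      simpa using hR j i (Finset.mem_Iic.1 hj) h
    have := Finset.card_le_card this
    rw [Fin.card_Iic] at this
    omega

theorem sum_fin_alternating (σ : ℝ) {m k : ℕ} (hk : k ≤ m) :
    ∑ i : Fin m, (if (i : ℕ) < k then -(2 * (σ * (-1) ^ (i : ℕ))) else 0) =
      σ * (-1) ^ k - σ := by
  rw [Fin.sum_univ_eq_sum_range (fun i => if i < k then -(2 * (σ * (-1 : ℝ) ^ i)) else 0) m,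
    ← Finset.sum_filter]
  have : (Finset.range m).filter (fun i => i < k) = Finset.range k := by
    ext i; simp only [Finset.mem_filter, Finset.mem_range]; omega
  rw [this]
  clear this hk
  induction k with
  | zero => simp
  | succ k ih => rw [Finset.sum_range_succ, ih]; ring

/-- The blown-up coordinates around the interface `α`. -/
noncomputable def blowup (δ h α : ℝ) (x : Pt) : Pt2 := ((x.1 - α) / δ, h * x.2.2 / δ)

/-- The recovery map obtained by superposing rescaled profiles `G i` along the interfaces. -/
noncomputable def recovery (a : V3) (lam σ δ h : ℝ) (k : V3) {m : ℕ} (α : Fin m → ℝ)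
    (G : Fin m → Pt2 → V3) (x : Pt) : V3 :=
  k + (σ * (x.1 + lam * (h * x.2.2))) • a + ∑ i, δ • G i (blowup δ h (α i) x)

theorem contDiff_blowup (δ h α : ℝ) : ContDiff ℝ 2 (blowup δ h α) := by
  unfold blowup; fun_prop

theorem hasFDerivAt_blowup (δ h α : ℝ) (x : Pt) : HasFDerivAt (blowup δ h α)
    (δ⁻¹ • ((ContinuousLinearMap.fst ℝ ℝ (ℝ × ℝ)).prod
      (h • (ContinuousLinearMap.snd ℝ ℝ ℝ).comp (ContinuousLinearMap.snd ℝ ℝ (ℝ × ℝ))))) x := by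
  have : blowup δ h α = fun x => (δ⁻¹ • ((ContinuousLinearMap.fst ℝ ℝ (ℝ × ℝ)).prod
      (h • (ContinuousLinearMap.snd ℝ ℝ ℝ).comp (ContinuousLinearMap.snd ℝ ℝ (ℝ × ℝ))))) x +
        (-α / δ, 0) := by
    funext x
    ext <;> simp [blowup] <;> ring
  rw [this]
  exact (ContinuousLinearMap.hasFDerivAt _).add_const _

theorem hasFDerivAt_comp_blowup {H : Pt2 → V3} (hH : Differentiable ℝ H) (δ h α : ℝ) (x : Pt) :
    HasFDerivAt (fun x => H (blowup δ h α x)) ((fderiv ℝ H (blowup δ h α x)).comp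
      (δ⁻¹ • ((ContinuousLinearMap.fst ℝ ℝ (ℝ × ℝ)).prod
      (h • (ContinuousLinearMap.snd ℝ ℝ ℝ).comp (ContinuousLinearMap.snd ℝ ℝ (ℝ × ℝ)))))) x :=
  ((hH _).hasFDerivAt).comp x (hasFDerivAt_blowup δ h α x)

theorem pd_sum_comp_blowup {m : ℕ} {H : Fin m → Pt2 → V3} (hH : ∀ i, Differentiable ℝ (H i))
    (T : Pt →L[ℝ] V3) (k : V3) (δ h : ℝ) (α : Fin m → ℝ) (e : Pt) (x : Pt) :
    pd e (fun x => k + T x + ∑ i, H i (blowup δ h (α i) x)) x =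
      T e + δ⁻¹ • ∑ i, fderiv ℝ (H i) (blowup δ h (α i) x) (e.1, h * e.2.2) := by
  have h1 := (((hasFDerivAt_const k x).add (T.hasFDerivAt (x := x))).add
    (HasFDerivAt.fun_sum (u := Finset.univ) fun i _ =>
      hasFDerivAt_comp_blowup (hH i) δ h (α i) x)).fderiv
  unfold pd
  erw [h1]
  simp only [zero_add, add_apply, sum_apply,
    ContinuousLinearMap.comp_apply, Finset.smul_sum, smul_apply, map_smul]
  congr 1

section

variable {a : V3} {lam σ δ h : ℝ} {k : V3} {m : ℕ} {α : Fin m → ℝ} {G : Fin m → Pt2 → V3}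

theorem contDiff_recovery (hG : ∀ i, ContDiff ℝ 2 (G i)) :
    ContDiff ℝ 2 (recovery a lam σ δ h k α G) := by
  unfold recovery
  have : ∀ i, ContDiff ℝ 2 fun x => G i (blowup δ h (α i) x) := fun i =>
    (hG i).comp (contDiff_blowup _ _ _)
  refine ContDiff.add (by fun_prop) (ContDiff.sum fun i _ => (this i).const_smul δ)

theorem pd_recovery (hδ : δ ≠ 0) (hG : ∀ i, ContDiff ℝ 2 (G i)) (e : Pt) (x : Pt) :
    pd e (recovery a lam σ δ h k α G) x = (σ * (e.1 + lam * (h * e.2.2))) • a +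
      ∑ i, fderiv ℝ (G i) (blowup δ h (α i) x) (e.1, h * e.2.2) := by
  have hd : ∀ i, Differentiable ℝ fun y => δ • G i y := fun i =>
    ((hG i).differentiable (by norm_num)).const_smul δ
  have := pd_sum_comp_blowup hd ((σ • (wellMap a lam).comp
    ((ContinuousLinearMap.fst ℝ ℝ (ℝ × ℝ)).prod
      (h • (ContinuousLinearMap.snd ℝ ℝ ℝ).comp (ContinuousLinearMap.snd ℝ ℝ (ℝ × ℝ))))))
    k δ h α e x
  have e0 : recovery a lam σ δ h k α G = (fun x => k + (σ • (wellMap a lam).comp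
    ((ContinuousLinearMap.fst ℝ ℝ (ℝ × ℝ)).prod
      (h • (ContinuousLinearMap.snd ℝ ℝ ℝ).comp (ContinuousLinearMap.snd ℝ ℝ (ℝ × ℝ))))) x +
        ∑ i, δ • G i (blowup δ h (α i) x)) := by
    funext x
    simp [recovery, wellMap_apply, mul_smul]
  rw [e0, this]
  congr 1
  · simp [wellMap_apply, mul_smul]
  · rw [Finset.smul_sum]
    refine Finset.sum_congr rfl fun i _ => ?_
    rw [fderiv_fun_const_smul ((hG i).differentiable (by norm_num) _)]
    simp [smul_smul, hδ]

theorem pd_e1_recovery (hδ : δ ≠ 0) (hG : ∀ i, ContDiff ℝ 2 (G i)) :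
    pd e1 (recovery a lam σ δ h k α G) =
      fun x => σ • a + ∑ i, qd f1 (G i) (blowup δ h (α i) x) := by
  funext x
  rw [pd_recovery hδ hG]
  simp [e1, qd, f1]

theorem pd_e2_recovery (hδ : δ ≠ 0) (hG : ∀ i, ContDiff ℝ 2 (G i)) :
    pd e2 (recovery a lam σ δ h k α G) = fun _ => 0 := by
  funext x
  rw [pd_recovery hδ hG]
  have : ((0 : ℝ), (0 : ℝ)) = (0 : Pt2) := rfl
  simp [e2, this]

theorem pd_e3_recovery (hδ : δ ≠ 0) (hG : ∀ i, ContDiff ℝ 2 (G i)) :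
    pd e3 (recovery a lam σ δ h k α G) =
      fun x => h • (σ • lam • a) + ∑ i, h • qd f2 (G i) (blowup δ h (α i) x) := by
  funext x
  rw [pd_recovery hδ hG]
  have : ((0 : ℝ), h) = h • f2 := by ext <;> simp [f2]
  simp only [e3, mul_one, zero_add, this, map_smul, qd]
  congr 1
  module

theorem hessh_recovery (hδ : δ ≠ 0) (hh : h ≠ 0) (hG : ∀ i, ContDiff ℝ 2 (G i)) (x : Pt) :
    hessh h (recovery a lam σ δ h k α G) x = (δ⁻¹) ^ 2 *
      (vnorm (∑ i, qd f1 (qd f1 (G i)) (blowup δ h (α i) x)) ^ 2 +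
        2 * vnorm (∑ i, qd f2 (qd f1 (G i)) (blowup δ h (α i) x)) ^ 2 +
        vnorm (∑ i, qd f2 (qd f2 (G i)) (blowup δ h (α i) x)) ^ 2) := by
  have hd : ∀ e i, Differentiable ℝ (qd e (G i)) := fun e i =>
    (contDiff_qd (hG i) e).differentiable (by norm_num)
  have hd' : ∀ e i, Differentiable ℝ fun y => h • qd e (G i) y := fun e i =>
    (hd e i).const_smul h
  have A1 : ∀ e, pd e (pd e1 (recovery a lam σ δ h k α G)) x =
      δ⁻¹ • ∑ i, fderiv ℝ (qd f1 (G i)) (blowup δ h (α i) x) (e.1, h * e.2.2) := fun e => by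
    rw [pd_e1_recovery hδ hG]
    have := pd_sum_comp_blowup (fun i => hd f1 i) 0 (σ • a) δ h α e x
    simpa using this
  have A2 : ∀ e, pd e (pd e2 (recovery a lam σ δ h k α G)) x = 0 := fun e => by
    rw [pd_e2_recovery hδ hG]; simp [pd]
  have A3 : ∀ e, pd e (pd e3 (recovery a lam σ δ h k α G)) x =
      δ⁻¹ • ∑ i, h • fderiv ℝ (qd f2 (G i)) (blowup δ h (α i) x) (e.1, h * e.2.2) := fun e => by
    rw [pd_e3_recovery hδ hG]
    have := pd_sum_comp_blowup (fun i => hd' f2 i) 0 (h • (σ • lam • a)) δ h α e x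
    have h2 : ∀ y i, fderiv ℝ (fun y => h • qd f2 (G i) y) y = h • fderiv ℝ (qd f2 (G i)) y :=
      fun y i => fderiv_fun_const_smul (hd f2 i y) h
    simpa [h2] using this
  have E1 : (e1.1, h * e1.2.2) = f1 := by simp [e1, f1]
  have E2 : (e2.1, h * e2.2.2) = 0 := by simp [e2]
  have E3 : (e3.1, h * e3.2.2) = h • f2 := by ext <;> simp [e3, f2]
  simp only [hessh, A1, A2, A3, E1, E2, E3, map_smul, map_zero, Finset.sum_const_zero, smul_zero,
    vnorm_zero, ← Finset.smul_sum, smul_smul, vnorm_smul, mul_pow, sq_abs]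
  simp only [qd]
  field_simp
  ring

end

theorem dotp_nuv_blowup (lam δ h α : ℝ) (x : Pt) :
    dotp (nuv lam) (blowup δ h α x) =
      (x.1 + lam * (h * x.2.2) - α) / (√(1 + lam ^ 2) * δ) := by
  rw [dotp_nuv, blowup]
  rcases eq_or_ne δ 0 with rfl | hδ
  · simp
  · have := (sqrt_one_add_sq_pos lam).ne'
    field_simp
    ring

section

variable {a : V3} {lam σ δ h : ℝ} {m : ℕ} {α : Fin m → ℝ} {G : Fin m → Pt2 → V3}

theorem dotp_blowup_anti (hδ : 0 < δ) (hα : Monotone α) (x : Pt) {i j : Fin m} (hij : i ≤ j) :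
    dotp (nuv lam) (blowup δ h (α j) x) ≤ dotp (nuv lam) (blowup δ h (α i) x) := by
  have := sqrt_one_add_sq_pos lam
  rw [dotp_nuv_blowup, dotp_nuv_blowup]
  gcongr
  exact hα hij

theorem dotp_blowup_gap (hδ : 0 < δ) (x : Pt) {i j : Fin m}
    (hgap : √(1 + lam ^ 2) * δ ≤ α j - α i) :
    dotp (nuv lam) (blowup δ h (α j) x) + 1 ≤ dotp (nuv lam) (blowup δ h (α i) x) := by
  have := sqrt_one_add_sq_pos lam
  rw [dotp_nuv_blowup, dotp_nuv_blowup, div_add_one (by positivity)]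
  gcongr
  linarith

theorem ite_smul_wellMap_sum (k : ℕ) (hk : k ≤ m) :
    ∑ i : Fin m, (if (i : ℕ) < k then -(2 * (σ * (-1) ^ (i : ℕ))) • wellMap a lam else 0) =
      (σ * (-1) ^ k - σ) • wellMap a lam := by
  rw [← sum_fin_alternating σ hk, Finset.sum_smul]
  refine Finset.sum_congr rfl fun i _ => ?_
  split_ifs
  · rfl
  · rw [zero_smul]

/-- Away from all interfaces the recovery map lies in one of the two wells. -/
theorem sum_fderiv_of_far (hG : ∀ i : Fin m, IsProfile a lam (σ * (-1) ^ (i : ℕ)) (G i)) {k : ℕ}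
    (hk : k ≤ m) {z : Fin m → Pt2} (hl : ∀ i : Fin m, (i : ℕ) < k → 1 / 2 ≤ dotp (nuv lam) (z i))
    (hr : ∀ i : Fin m, k ≤ (i : ℕ) → dotp (nuv lam) (z i) ≤ -(1 / 2)) :
    ∑ i, fderiv ℝ (G i) (z i) = (σ * (-1) ^ k - σ) • wellMap a lam := by
  rw [← ite_smul_wellMap_sum k hk]
  refine Finset.sum_congr rfl fun i _ => ?_
  split_ifs with hi
  · exact ((hG i).fderiv_right (hl i hi)).self_of_nhds
  · exact ((hG i).fderiv_left (hr i (not_lt.1 hi))).self_of_nhds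

theorem gradh_recovery (hδ : δ ≠ 0) (hh : h ≠ 0) (hG : ∀ i, ContDiff ℝ 2 (G i)) (k : V3) (x : Pt) :
    gradh h (recovery a lam σ δ h k α G) x =
      ![σ • a + (∑ i, fderiv ℝ (G i) (blowup δ h (α i) x)) f1, 0,
        σ • lam • a + (∑ i, fderiv ℝ (G i) (blowup δ h (α i) x)) f2] := by
  rw [gradh, pd_e1_recovery hδ hG, pd_e2_recovery hδ hG, pd_e3_recovery hδ hG]
  simp only [sum_apply, ← Finset.smul_sum, ← smul_add, qd, inv_smul_smul₀ hh]

/-- The energy density of the recovery map is carried by the profiles. -/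
theorem density_recovery_le {W : M33 → ℝ} (hW : ∀ ξ, 0 ≤ W ξ)
    (hWp : W ![a, 0, lam • a] = 0) (hWm : W ![-a, 0, -(lam • a)] = 0)
    (hσ : σ = 1 ∨ σ = -1) {ℓ ε : ℝ} (hℓ : 0 < ℓ) (hε : 0 < ε) (hh : h ≠ 0)
    (hgap : ∀ i j, i < j → √(1 + lam ^ 2) * (ℓ * ε) ≤ α j - α i) (hα : Monotone α)
    (hG : ∀ i : Fin m, IsProfile a lam (σ * (-1) ^ (i : ℕ)) (G i)) (k : V3) (x : Pt) :
    ε⁻¹ * W (gradh h (recovery a lam σ (ℓ * ε) h k α G) x) +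
        ε * hessh h (recovery a lam σ (ℓ * ε) h k α G) x ≤
      ∑ i : Fin m, ε⁻¹ * (ℓ⁻¹ * cellDensity W a lam (σ * (-1) ^ (i : ℕ)) ℓ (G i)
        (blowup (ℓ * ε) h (α i) x)) := by
  classical
  have hδ : 0 < ℓ * ε := mul_pos hℓ hε
  have hGc : ∀ i, ContDiff ℝ 2 (G i) := fun i => (hG i).contDiff
  set z : Fin m → Pt2 := fun i => blowup (ℓ * ε) h (α i) x with hz
  set R : Fin m → Prop := fun i => 1 / 2 ≤ dotp (nuv lam) (z i) with hR
  set K := (Finset.univ.filter R).card with hK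
  have hmono : ∀ i j, i ≤ j → R j → R i := fun i j hij hj =>
    le_trans hj (dotp_blowup_anti hδ hα x hij)
  have hKR : ∀ i : Fin m, (i : ℕ) < K ↔ R i := Fin.lt_card_filter_iff R hmono
  have hKm : K ≤ m := by simpa using Finset.card_le_univ (Finset.univ.filter R)
  have hnn : ∀ i : Fin m, 0 ≤ ε⁻¹ * (ℓ⁻¹ * cellDensity W a lam (σ * (-1) ^ (i : ℕ)) ℓ (G i) (z i)) :=
    fun i => mul_nonneg (inv_pos.2 hε).le (mul_nonneg (inv_pos.2 hℓ).le
      (cellDensity_nonneg hW _ _ _ hℓ _ _))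
  have hτ : ∀ n : ℕ, σ * (-1) ^ n = 1 ∨ σ * (-1) ^ n = -1 := fun n => by
    rcases neg_one_pow_eq_or ℝ n with e | e <;> rcases hσ with r | r <;> simp [e, r]
  have hh2 : ∀ (e e' : Pt2), ∀ i : Fin m, 1 / 2 ≤ |dotp (nuv lam) (z i)| →
      qd e' (qd e (G i)) (z i) = 0 := fun e e' i hi => (hG i).qd_qd_eq_zero hi e e'
  rw [gradh_recovery hδ.ne' hh hGc, hessh_recovery hδ.ne' hh hGc]
  by_cases hlast : ∃ i : Fin m, (i : ℕ) = K
  · obtain ⟨q, hq⟩ := hlast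
    have hfar : ∀ i, i ≠ q → 1 / 2 ≤ |dotp (nuv lam) (z i)| ∧
        fderiv ℝ (G i) (z i) =
          if (i : ℕ) < K then -(2 * (σ * (-1) ^ (i : ℕ))) • wellMap a lam else 0 := by
      intro i hi
      rcases lt_or_gt_of_ne hi with hlt | hgt
      · have hiK : (i : ℕ) < K := by rw [← hq]; exact hlt
        have hRi := (hKR i).1 hiK
        rw [if_pos hiK]
        exact ⟨hRi.trans (le_abs_self _), ((hG i).fderiv_right hRi).self_of_nhds⟩
      · have hRq : ¬ R q := fun hc => by have := (hKR q).2 hc; omega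
        have hqi : ¬ (i : ℕ) < K := by rw [← hq]; exact not_lt.2 hgt.le
        have h1 := dotp_blowup_gap (h := h) hδ x (hgap q i hgt)
        have h2 : dotp (nuv lam) (z i) ≤ -(1 / 2) := by
          simp only [hR, not_le] at hRq
          change dotp (nuv lam) (z i) + 1 ≤ dotp (nuv lam) (z q) at h1
          linarith
        rw [if_neg hqi]
        exact ⟨le_abs.2 (Or.inr (by linarith)), ((hG i).fderiv_left h2).self_of_nhds⟩
    have hsum : ∑ i, fderiv ℝ (G i) (z i) =
        fderiv ℝ (G q) (z q) + (σ * (-1) ^ K - σ) • wellMap a lam := by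
      rw [← ite_smul_wellMap_sum K hKm, ← Finset.add_sum_erase _ _ (Finset.mem_univ q),
        ← Finset.add_sum_erase (a := q) (f := fun i : Fin m => if (i : ℕ) < K then
          -(2 * (σ * (-1) ^ (i : ℕ))) • wellMap a lam else 0) _ (Finset.mem_univ q)]
      simp only [hq, lt_irrefl, if_false, zero_add]
      congr 1
      exact Finset.sum_congr rfl fun i hi => (hfar i (Finset.ne_of_mem_erase hi)).2
    have hH : ∀ e e', ∑ i, qd e' (qd e (G i)) (z i) = qd e' (qd e (G q)) (z q) := fun e e' =>
      Finset.sum_eq_single q (fun i _ hi => hh2 e e' i (hfar i hi).1) (by simp)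
    refine le_trans (le_of_eq ?_) (Finset.single_le_sum (fun i _ => hnn i) (Finset.mem_univ q))
    change ε⁻¹ * W ![σ • a + (∑ i, fderiv ℝ (G i) (z i)) f1, 0,
      σ • lam • a + (∑ i, fderiv ℝ (G i) (z i)) f2] + ε * ((ℓ * ε)⁻¹ ^ 2 *
        (vnorm (∑ i, qd f1 (qd f1 (G i)) (z i)) ^ 2 +
        2 * vnorm (∑ i, qd f2 (qd f1 (G i)) (z i)) ^ 2 +
        vnorm (∑ i, qd f2 (qd f2 (G i)) (z i)) ^ 2)) = _
    have e1 : σ • a + (∑ i, fderiv ℝ (G i) (z i)) f1 = qd f1 (G q) (z q) + (σ * (-1) ^ K) • a := by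
      rw [hsum]; simp only [add_apply, smul_apply, wellMap_f1, qd]; module
    have e2 : σ • lam • a + (∑ i, fderiv ℝ (G i) (z i)) f2 =
        qd f2 (G q) (z q) + (σ * (-1) ^ K) • (lam • a) := by
      rw [hsum]; simp only [add_apply, smul_apply, wellMap_f2, qd]; module
    rw [e1, e2, hH, hH, hH, hq]
    simp only [cellDensity, hess2d]
    field_simp
  · have hl : ∀ i : Fin m, (i : ℕ) < K := fun i => by
      by_contra hc
      have := i.2
      exact hlast ⟨⟨K, by omega⟩, rfl⟩
    have hsum := sum_fderiv_of_far hG hKm (z := z) (fun i hi => (hKR i).1 hi)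
      (fun i hi => absurd (hl i) (by omega))
    have hH : ∀ e e', ∑ i, qd e' (qd e (G i)) (z i) = 0 := fun e e' =>
      Finset.sum_eq_zero fun i _ => hh2 e e' i (((hKR i).1 (hl i)).trans (le_abs_self _))
    refine le_trans (le_of_eq ?_) (Finset.sum_nonneg fun i _ => hnn i)
    change ε⁻¹ * W ![σ • a + (∑ i, fderiv ℝ (G i) (z i)) f1, 0,
      σ • lam • a + (∑ i, fderiv ℝ (G i) (z i)) f2] + ε * ((ℓ * ε)⁻¹ ^ 2 *
        (vnorm (∑ i, qd f1 (qd f1 (G i)) (z i)) ^ 2 +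
        2 * vnorm (∑ i, qd f2 (qd f1 (G i)) (z i)) ^ 2 +
        vnorm (∑ i, qd f2 (qd f2 (G i)) (z i)) ^ 2)) = _
    have e1 : σ • a + (∑ i, fderiv ℝ (G i) (z i)) f1 = (σ * (-1) ^ K) • a := by
      rw [hsum]; simp only [smul_apply, wellMap_f1]; module
    have e2 : σ • lam • a + (∑ i, fderiv ℝ (G i) (z i)) f2 = (σ * (-1) ^ K) • (lam • a) := by
      rw [hsum]; simp only [smul_apply, wellMap_f2]; module
    rw [e1, e2, hH, hH, hH]
    rcases hτ K with e | e <;> simp [e, hWp, hWm, vnorm_zero]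

end

theorem Fin.lt_cnt_iff {m : ℕ} {α : Fin m → ℝ} (hα : Monotone α) (t : ℝ) (i : Fin m) :
    (i : ℕ) < cnt m α t ↔ α i < t := by
  classical
  have := Fin.lt_card_filter_iff (fun i => α i < t) (fun i j hij hj => (hα hij).trans_lt hj) i
  simpa [cnt] using this

theorem cnt_le {m : ℕ} (α : Fin m → ℝ) (t : ℝ) : cnt m α t ≤ m := by
  unfold cnt
  simpa using Finset.card_le_univ (Finset.univ.filter fun i => α i < t)

theorem measurable_cnt {m : ℕ} (α : Fin m → ℝ) : Measurable (cnt m α) := by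
  unfold cnt
  simp only [Finset.card_filter]
  exact Finset.measurable_sum _ fun i _ =>
    Measurable.ite measurableSet_Ioi measurable_const measurable_const

theorem eq_of_hasDerivAt_zero_off_countable {E : Type*} [NormedAddCommGroup E] [NormedSpace ℝ E]
    [CompleteSpace E] {f : ℝ → E} {s : Set ℝ} (hs : s.Countable) (hf : Continuous f)
    (hd : ∀ t ∉ s, HasDerivAt f 0 t) (x y : ℝ) : f x = f y := by
  have := integral_eq_of_hasDerivAt_off_countable (a := y) (b := x) f (fun _ => 0) hs
    hf.continuousOn (fun t ht => hd t ht.2) (by simp)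
  simpa [sub_eq_zero, eq_comm] using this

theorem hasDerivAt_max_sub {α t : ℝ} (h : t ≠ α) :
    HasDerivAt (fun t => max (t - α) 0) (if α < t then 1 else 0) t := by
  split_ifs with hlt
  · refine ((hasDerivAt_id t).sub_const α).congr_of_eventuallyEq ?_
    filter_upwards [lt_mem_nhds hlt] with s hs
    exact max_eq_left (by simpa using hs.le)
  · refine (hasDerivAt_const t (0 : ℝ)).congr_of_eventuallyEq ?_
    filter_upwards [gt_mem_nhds (lt_of_le_of_ne (not_lt.1 hlt) h)] with s hs
    exact max_eq_right (by simpa using hs.le)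

/-- A piecewise affine laminate is a superposition of kinks. -/
theorem exists_laminate_eq {a : V3} {σ : ℝ} {m : ℕ} {α : Fin m → ℝ} (hα : Monotone α)
    {ubar : ℝ → V3} (hc : Continuous ubar)
    (hd : ∀ t, t ∉ range α → HasDerivAt ubar ((σ * (-1 : ℝ) ^ (cnt m α t)) • a) t) :
    ∃ k : V3, ∀ t, ubar t = k + (σ * t) • a +
      ∑ i : Fin m, (-(2 * (σ * (-1) ^ (i : ℕ))) * max (t - α i) 0) • a := by
  set g : ℝ → V3 := fun t => (σ * t) • a +
      ∑ i : Fin m, (-(2 * (σ * (-1) ^ (i : ℕ))) * max (t - α i) 0) • a with hg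
  have hgc : Continuous g := by
    rw [hg]
    fun_prop
  have hgd : ∀ t, t ∉ range α → HasDerivAt g ((σ * (-1 : ℝ) ^ (cnt m α t)) • a) t := by
    intro t ht
    have h1 : HasDerivAt (fun t => (σ * t) • a) ((σ * 1) • a) t :=
      ((hasDerivAt_id t).const_mul σ).smul_const a
    have h2 := HasDerivAt.fun_sum (u := Finset.univ) fun (i : Fin m) _ =>
      ((hasDerivAt_max_sub (α := α i) (t := t) (fun e => ht ⟨i, e.symm⟩)).const_mul
        (-(2 * (σ * (-1) ^ (i : ℕ))))).smul_const a
    refine (h1.add h2).congr_deriv ?_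
    rw [← Finset.sum_smul, ← add_smul]
    congr 1
    have := sum_fin_alternating σ (cnt_le α t)
    simp only [Fin.lt_cnt_iff hα] at this
    simp only [mul_ite, mul_one, mul_zero, this]
    ring
  refine ⟨ubar 0 - g 0, fun t => ?_⟩
  have := eq_of_hasDerivAt_zero_off_countable (f := fun t => ubar t - g t)
    (finite_range α).countable (hc.sub hgc)
    (fun t ht => ((hd t ht).sub (hgd t ht)).congr_deriv (sub_self _)) t 0
  rw [← this, add_assoc]
  change ubar t = ubar t - g t + g t
  simp

theorem Om_isBounded {ω : Set (ℝ × ℝ)} (h : Bornology.IsBounded ω) :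
    Bornology.IsBounded (Om ω) := by
  obtain ⟨C, hC⟩ := isBounded_iff_forall_norm_le.1 h
  refine isBounded_iff_forall_norm_le.2 ⟨max C 1, fun x hx => ?_⟩
  have h1 := hC _ hx.1
  have h2 : |x.2.2| ≤ 1 := abs_le.2 ⟨by linarith [hx.2.1], by linarith [hx.2.2]⟩
  simp only [Prod.norm_def, Real.norm_eq_abs, max_le_iff] at h1 ⊢
  exact ⟨le_max_of_le_left h1.1, le_max_of_le_left h1.2, le_max_of_le_right h2⟩

theorem tendsto_lintegral_vnorm_rpow {U : Set Pt} (hU : volume U ≠ ⊤) (hUm : MeasurableSet U)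
    {p : ℝ} (hp : 0 < p)
    {g : ℕ → Pt → V3} (hg : ∀ n, Measurable (g n)) {C : ℝ}
    (hb : ∀ᶠ n in atTop, ∀ x ∈ U, ‖g n x‖ ≤ C)
    (hl : ∀ᵐ x, x ∈ U → Tendsto (fun n => g n x) atTop (𝓝 0)) :
    Tendsto (fun n => ∫⁻ x in U, ENNReal.ofReal (vnorm (g n x) ^ p)) atTop (𝓝 0) := by
  have hmeas : ∀ n, Measurable fun x => ENNReal.ofReal (vnorm (g n x) ^ p) := fun n =>
    ((continuous_vnorm.measurable.comp (hg n)).pow_const p).ennreal_ofReal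
  have := tendsto_lintegral_filter_of_dominated_convergence (μ := volume.restrict U)
    (l := atTop) (F := fun n x => ENNReal.ofReal (vnorm (g n x) ^ p)) (f := fun _ => 0)
    (fun _ => ENNReal.ofReal ((2 * C) ^ p)) (Eventually.of_forall hmeas) ?_ ?_ ?_
  · simpa using this
  · filter_upwards [hb] with n hn
    filter_upwards [ae_restrict_mem hUm] with x hx
    exact ENNReal.ofReal_le_ofReal (Real.rpow_le_rpow (vnorm_nonneg _)
      ((vnorm_le _).trans (by linarith [hn x hx])) hp.le)
  · simp only [lintegral_const, Measure.restrict_apply_univ]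
    exact ENNReal.mul_ne_top ENNReal.ofReal_ne_top hU
  · filter_upwards [(ae_restrict_iff' hUm).2 hl] with x hx
    have h1 := ((continuous_vnorm.tendsto 0).comp hx)
    rw [vnorm_zero] at h1
    have h2 := (h1.rpow_const (p := p) (Or.inr hp.le))
    rw [Real.zero_rpow hp.ne'] at h2
    simpa using ENNReal.tendsto_ofReal h2

theorem ae_fst_notMem_range {m : ℕ} (α : Fin m → ℝ) : ∀ᵐ x : Pt, x.1 ∉ range α :=
  Measure.quasiMeasurePreserving_fst.ae ((finite_range α).countable.ae_notMem volume)

section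

variable {a : V3} {lam σ : ℝ} {m : ℕ} {α : Fin m → ℝ} {G : Fin m → Pt2 → V3} {k : V3}

theorem abs_mul_neg_one_pow (hσ : σ = 1 ∨ σ = -1) (n : ℕ) : |σ * (-1) ^ n| = 1 := by
  rcases hσ with rfl | rfl <;> simp [abs_pow]

/-- The recovery map is uniformly close to the laminate. -/
theorem exists_norm_recovery_sub_le (hσ : σ = 1 ∨ σ = -1)
    (hG : ∀ i : Fin m, IsProfile a lam (σ * (-1) ^ (i : ℕ)) (G i)) :
    ∃ C : ℝ, ∀ (k : V3) (δ h : ℝ) (x : Pt), 0 < δ → 0 < h → |x.2.2| ≤ 1 →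
      ‖recovery a lam σ δ h k α G x - (k + (σ * x.1) • a +
        ∑ i : Fin m, (-(2 * (σ * (-1) ^ (i : ℕ))) * max (x.1 - α i) 0) • a)‖ ≤ C * (δ + h) := by
  choose D hD using fun i => (hG i).exists_bound_sub
  have hD0 : ∀ i, 0 ≤ D i := fun i => (norm_nonneg _).trans (hD i 0)
  refine ⟨|lam| * ‖a‖ + ∑ i : Fin m, (D i + 2 * (|lam| * ‖a‖)), fun k δ h x hδ hh hx => ?_⟩
  set r := lam * (h * x.2.2) with hr
  have hrle : |r| ≤ |lam| * h := by
    rw [hr, abs_mul, abs_mul, abs_of_pos hh]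
    gcongr
    exact mul_le_of_le_one_right hh.le hx
  have hs1 : |σ| = 1 := by simpa using abs_mul_neg_one_pow hσ 0
  have key : recovery a lam σ δ h k α G x - (k + (σ * x.1) • a +
        ∑ i : Fin m, (-(2 * (σ * (-1) ^ (i : ℕ))) * max (x.1 - α i) 0) • a) =
      (σ * r) • a + ∑ i : Fin m, (δ • (G i (blowup δ h (α i) x) + (2 * (σ * (-1) ^ (i : ℕ)) *
        max ((blowup δ h (α i) x).1 + lam * (blowup δ h (α i) x).2) 0) • a) +
        (2 * (σ * (-1) ^ (i : ℕ)) * (max (x.1 - α i) 0 - max (x.1 - α i + r) 0)) • a) := by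
    have hmax : ∀ i, δ * max ((blowup δ h (α i) x).1 + lam * (blowup δ h (α i) x).2) 0 =
        max (x.1 - α i + r) 0 := fun i => by
      rw [mul_max_of_nonneg _ _ hδ.le, mul_zero]
      congr 1
      simp only [blowup, hr]
      field_simp
    have : ∀ i : Fin m, (δ • (G i (blowup δ h (α i) x) + (2 * (σ * (-1) ^ (i : ℕ)) *
        max ((blowup δ h (α i) x).1 + lam * (blowup δ h (α i) x).2) 0) • a) +
        (2 * (σ * (-1) ^ (i : ℕ)) * (max (x.1 - α i) 0 - max (x.1 - α i + r) 0)) • a) =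
        δ • G i (blowup δ h (α i) x) -
          (-(2 * (σ * (-1) ^ (i : ℕ))) * max (x.1 - α i) 0) • a := fun i => by
      rw [← hmax i]; module
    simp only [this, Finset.sum_sub_distrib, recovery, ← hr]
    module
  rw [key]
  have hterm : ∀ i : Fin m, ‖(δ • (G i (blowup δ h (α i) x) + (2 * (σ * (-1) ^ (i : ℕ)) *
        max ((blowup δ h (α i) x).1 + lam * (blowup δ h (α i) x).2) 0) • a) +
        (2 * (σ * (-1) ^ (i : ℕ)) * (max (x.1 - α i) 0 - max (x.1 - α i + r) 0)) • a)‖ ≤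
      (D i + 2 * (|lam| * ‖a‖)) * (δ + h) := fun i => by
    refine (norm_add_le _ _).trans ?_
    rw [norm_smul, norm_smul, Real.norm_eq_abs, abs_of_pos hδ, Real.norm_eq_abs, abs_mul, abs_mul,
      abs_mul_neg_one_pow hσ, abs_two, mul_one]
    have h1 : |max (x.1 - α i) 0 - max (x.1 - α i + r) 0| ≤ |lam| * h := by
      refine (abs_max_sub_max_le_abs _ _ _).trans ?_
      rw [sub_add_cancel_left, abs_neg]; exact hrle
    calc _ ≤ δ * D i + 2 * (|lam| * h) * ‖a‖ := by gcongr; exact hD i _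
      _ ≤ _ := by
        have := mul_nonneg (hD0 i) hh.le
        have := mul_nonneg (mul_nonneg (abs_nonneg lam) (norm_nonneg a)) hδ.le
        linarith
  have h0 : ‖(σ * r) • a‖ ≤ |lam| * ‖a‖ * (δ + h) := by
    rw [norm_smul, Real.norm_eq_abs, abs_mul, hs1, one_mul]
    have := mul_nonneg (mul_nonneg (abs_nonneg lam) (norm_nonneg a)) hδ.le
    have := mul_le_mul_of_nonneg_right hrle (norm_nonneg a)
    linarith
  rw [add_mul, Finset.sum_mul]
  exact (norm_add_le _ _).trans (add_le_add h0 (norm_sum_le_of_le _ fun i _ => hterm i))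

theorem exists_norm_pd_recovery_le (a : V3) (lam σ : ℝ)
    (hG : ∀ i : Fin m, IsProfile a lam (σ * (-1) ^ (i : ℕ)) (G i)) :
    ∃ C : ℝ, ∀ (k : V3) (δ h : ℝ) (x : Pt), δ ≠ 0 → h ≠ 0 →
      ‖pd e1 (recovery a lam σ δ h k α G) x‖ ≤ C ∧
      ‖h⁻¹ • pd e3 (recovery a lam σ δ h k α G) x‖ ≤ C := by
  choose D hD using fun i => (hG i).exists_bound_fderiv
  have hf1 : ‖f1‖ ≤ 1 := by simp [f1, Prod.norm_def]
  have hf2 : ‖f2‖ ≤ 1 := by simp [f2, Prod.norm_def]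
  have hqd : ∀ e : Pt2, ‖e‖ ≤ 1 → ∀ i z, ‖qd e (G i) z‖ ≤ D i := fun e he i z => by
    refine (ContinuousLinearMap.le_opNorm _ _).trans ?_
    exact (mul_le_of_le_one_right (norm_nonneg _) he).trans (hD i z)
  refine ⟨max ‖σ • a‖ ‖σ • lam • a‖ + ∑ i, D i, fun k δ h x hδ hh => ⟨?_, ?_⟩⟩
  · rw [pd_e1_recovery hδ fun i => (hG i).contDiff]
    exact (norm_add_le _ _).trans (add_le_add (le_max_left _ _)
      (norm_sum_le_of_le _ fun i _ => hqd f1 hf1 i _))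
  · rw [pd_e3_recovery hδ fun i => (hG i).contDiff]
    simp only [← Finset.smul_sum, ← smul_add, inv_smul_smul₀ hh]
    exact (norm_add_le _ _).trans (add_le_add (le_max_right _ _)
      (norm_sum_le_of_le _ fun i _ => hqd f2 hf2 i _))

/-- Away from the interfaces the rescaled gradient eventually reaches the wells. -/
theorem eventually_pd_recovery_eq (hα : Monotone α)
    (hG : ∀ i : Fin m, IsProfile a lam (σ * (-1) ^ (i : ℕ)) (G i)) (k : V3)
    {δ h : ℕ → ℝ} (hδ : ∀ n, 0 < δ n) (hh : ∀ n, 0 < h n)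
    (hδ0 : Tendsto δ atTop (𝓝 0)) (hh0 : Tendsto h atTop (𝓝 0)) {x : Pt} (hx : x.1 ∉ range α) :
    ∀ᶠ n in atTop, pd e1 (recovery a lam σ (δ n) (h n) k α G) x =
        (σ * (-1) ^ cnt m α x.1) • a ∧
      (h n)⁻¹ • pd e3 (recovery a lam σ (δ n) (h n) k α G) x =
        (σ * (-1) ^ cnt m α x.1) • (lam • a) := by
  have hs := sqrt_one_add_sq_pos lam
  have hnum : ∀ i, Tendsto (fun n => x.1 + lam * (h n * x.2.2) - α i) atTop (𝓝 (x.1 - α i)) :=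
    fun i => by
      have := ((((hh0.mul_const x.2.2).const_mul lam).const_add x.1).sub_const (α i))
      simpa using this
  have hden : Tendsto (fun n => √(1 + lam ^ 2) * δ n) atTop (𝓝 0) := by
    simpa using hδ0.const_mul (√(1 + lam ^ 2))
  have hev : ∀ᶠ n in atTop, ∀ i, (α i < x.1 → 1 / 2 ≤ dotp (nuv lam) (blowup (δ n) (h n) (α i) x)) ∧
      (¬ α i < x.1 → dotp (nuv lam) (blowup (δ n) (h n) (α i) x) ≤ -(1 / 2)) := by
    refine eventually_all.2 fun i => ?_
    by_cases hlt : α i < x.1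
    · simp only [hlt, true_imp_iff, not_true_eq_false, false_imp_iff, and_true]
      have h1 := (hnum i).sub (hden.const_mul (1 / 2))
      filter_upwards [h1.eventually_const_lt (u := 0) (by simpa using hlt)] with n hn
      rw [dotp_nuv_blowup, le_div_iff₀ (mul_pos hs (hδ n))]
      linarith
    · have hgt : x.1 < α i := lt_of_le_of_ne (not_lt.1 hlt) fun e => hx ⟨i, e.symm⟩
      simp only [hlt, not_false_eq_true, true_imp_iff, false_imp_iff, true_and]
      have h1 := (hnum i).add (hden.const_mul (1 / 2))
      filter_upwards [h1.eventually_lt_const (u := 0) (by simpa using hgt)] with n hn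
      rw [dotp_nuv_blowup, div_le_iff₀ (mul_pos hs (hδ n))]
      linarith
  filter_upwards [hev] with n hn
  have hsum := sum_fderiv_of_far hG (cnt_le α x.1) (z := fun i => blowup (δ n) (h n) (α i) x)
    (fun i hi => (hn i).1 ((Fin.lt_cnt_iff hα _ _).1 hi))
    (fun i hi => (hn i).2 fun hc => absurd ((Fin.lt_cnt_iff hα _ _).2 hc) (not_lt.2 hi))
  have hg := gradh_recovery (a := a) (lam := lam) (σ := σ) (α := α) (hδ n).ne' (hh n).ne' (fun i => (hG i).contDiff) k x
  have g0 := congrFun hg 0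
  have g2 := congrFun hg 2
  simp only [gradh, hsum, smul_apply, wellMap_f1, wellMap_f2, Matrix.cons_val_zero,
    Matrix.cons_val] at g0 g2
  rw [g0, g2]
  constructor <;> module

theorem measurable_phase (σ : ℝ) (α : Fin m → ℝ) (w : V3) :
    Measurable fun x : Pt => (σ * (-1) ^ cnt m α x.1) • w := by
  have h1 : Measurable fun n : ℕ => (σ * (-1) ^ n) • w := measurable_from_nat
  exact h1.comp ((measurable_cnt α).comp measurable_fst)

theorem continuous_pd {u : Pt → V3} (hu : ContDiff ℝ 2 u) (e : Pt) : Continuous (pd e u) :=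
  (hu.continuous_fderiv (by norm_num)).clm_apply continuous_const

/-- The recovery maps converge to the laminate. -/
theorem tendsto_recovery {ω : Set (ℝ × ℝ)} (hωo : IsOpen ω) (hωb : Bornology.IsBounded ω)
    {p : ℝ} (hp : 0 < p) (hσ : σ = 1 ∨ σ = -1) (hα : Monotone α) {ubar : ℝ → V3}
    (hub : ∀ t, ubar t = k + (σ * t) • a +
      ∑ i : Fin m, (-(2 * (σ * (-1) ^ (i : ℕ))) * max (t - α i) 0) • a)
    (hG : ∀ i : Fin m, IsProfile a lam (σ * (-1) ^ (i : ℕ)) (G i))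
    {δ h : ℕ → ℝ} (hδ : ∀ n, 0 < δ n) (hh : ∀ n, 0 < h n)
    (hδ0 : Tendsto δ atTop (𝓝 0)) (hh0 : Tendsto h atTop (𝓝 0)) :
    Tendsto (fun n => ∫⁻ x in Om ω, ENNReal.ofReal
        ((vnorm (recovery a lam σ (δ n) (h n) k α G x - ubar x.1)) ^ p
          + (vnorm (pd e1 (recovery a lam σ (δ n) (h n) k α G) x -
              (σ * (-1 : ℝ) ^ (cnt m α x.1)) • a)) ^ p
          + (vnorm (pd e2 (recovery a lam σ (δ n) (h n) k α G) x)) ^ p)) atTop (𝓝 0) ∧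
      TendsLp (Om ω) p (fun n x => (h n)⁻¹ • pd e3 (recovery a lam σ (δ n) (h n) k α G) x)
        (fun x => (σ * (-1 : ℝ) ^ (cnt m α x.1)) • (lam • a)) := by
  have hUo := isOpen_Om hωo
  have hU : volume (Om ω) ≠ ⊤ := (Om_isBounded hωb).measure_lt_top.ne
  have hcd : ∀ n, ContDiff ℝ 2 (recovery a lam σ (δ n) (h n) k α G) := fun n =>
    contDiff_recovery fun i => (hG i).contDiff
  have hubm : Continuous ubar := by
    rw [funext hub]; fun_prop
  obtain ⟨C, hC⟩ := exists_norm_recovery_sub_le (α := α) hσ hG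
  obtain ⟨D, hD⟩ := exists_norm_pd_recovery_le (α := α) a lam σ hG
  have hx3 : ∀ x ∈ Om ω, |x.2.2| ≤ 1 := fun x hx =>
    abs_le.2 ⟨by linarith [hx.2.1], by linarith [hx.2.2]⟩
  have hdist : ∀ n, ∀ x ∈ Om ω,
      ‖recovery a lam σ (δ n) (h n) k α G x - ubar x.1‖ ≤ C * (δ n + h n) := fun n x hx => by
    rw [hub]; exact hC k _ _ x (hδ n) (hh n) (hx3 x hx)
  have hCt : Tendsto (fun n => C * (δ n + h n)) atTop (𝓝 0) := by
    simpa using (hδ0.add hh0).const_mul C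
  have habs : ∀ n, ∀ w : V3, ‖(σ * (-1) ^ n) • w‖ = ‖w‖ := fun n w => by
    rw [norm_smul, Real.norm_eq_abs, abs_mul_neg_one_pow hσ, one_mul]
  have T1 := tendsto_lintegral_vnorm_rpow hU hUo.measurableSet hp
    (g := fun n x => recovery a lam σ (δ n) (h n) k α G x - ubar x.1)
    (fun n => ((hcd n).continuous.sub (hubm.comp continuous_fst)).measurable) (C := 1)
    (by
      filter_upwards [hCt.eventually_le_const (u := 1) one_pos] with n hn x hx
      exact (hdist n x hx).trans hn)
    (Eventually.of_forall fun x hx => squeeze_zero_norm (fun n => hdist n x hx) hCt)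
  have T2 := tendsto_lintegral_vnorm_rpow hU hUo.measurableSet hp
    (g := fun n x => pd e1 (recovery a lam σ (δ n) (h n) k α G) x - (σ * (-1) ^ cnt m α x.1) • a)
    (fun n => (continuous_pd (hcd n) _).measurable.sub (measurable_phase σ α a)) (C := D + ‖a‖)
    (Eventually.of_forall fun n x _ => (norm_sub_le _ _).trans
      (add_le_add (hD k _ _ x (hδ n).ne' (hh n).ne').1 (habs _ _).le))
    (by
      filter_upwards [ae_fst_notMem_range α] with x hx _
      refine tendsto_const_nhds.congr' ?_
      filter_upwards [eventually_pd_recovery_eq hα hG k hδ hh hδ0 hh0 hx] with n hn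
      rw [hn.1, sub_self])
  have T3 := tendsto_lintegral_vnorm_rpow hU hUo.measurableSet hp
    (g := fun n x => (h n)⁻¹ • pd e3 (recovery a lam σ (δ n) (h n) k α G) x -
      (σ * (-1) ^ cnt m α x.1) • (lam • a))
    (fun n => ((continuous_pd (hcd n) e3).const_smul (h n)⁻¹).measurable.sub
      (measurable_phase σ α (lam • a))) (C := D + ‖lam • a‖)
    (Eventually.of_forall fun n x _ => (norm_sub_le _ _).trans
      (add_le_add (hD k _ _ x (hδ n).ne' (hh n).ne').2 (habs _ _).le))
    (by
      filter_upwards [ae_fst_notMem_range α] with x hx _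
      refine tendsto_const_nhds.congr' ?_
      filter_upwards [eventually_pd_recovery_eq hα hG k hδ hh hδ0 hh0 hx] with n hn
      rw [hn.2, sub_self])
  refine ⟨?_, T3⟩
  have hT := T1.add T2
  rw [add_zero] at hT
  refine hT.congr fun n => ?_
  have hm : Measurable fun x => ENNReal.ofReal
      (vnorm (recovery a lam σ (δ n) (h n) k α G x - ubar x.1) ^ p) :=
    ((continuous_vnorm.comp ((hcd n).continuous.sub
      (hubm.comp continuous_fst))).measurable.pow_const p).ennreal_ofReal
  rw [← lintegral_add_left hm]
  refine lintegral_congr fun x => ?_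
  rw [← ENNReal.ofReal_add (Real.rpow_nonneg (vnorm_nonneg _) _)
    (Real.rpow_nonneg (vnorm_nonneg _) _), pd_e2_recovery (hδ n).ne' fun i => (hG i).contDiff,
    vnorm_zero, Real.zero_rpow hp.ne', add_zero]

end

theorem tendsto_inv_succ : Tendsto (fun j : ℕ => (j + 1 : ℝ≥0∞)⁻¹) atTop (𝓝 0) := by
  simpa using (tendsto_add_atTop_iff_nat 1).2 ENNReal.tendsto_inv_nat_nhds_zero

theorem setLIntegral_Qlam_lt_top (lam : ℝ) {f : Pt2 → ℝ} (hf : Continuous f) :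
    ∫⁻ y in Qlam lam, ENNReal.ofReal (f y) < ⊤ := by
  set T : ℝ × ℝ → Pt2 := fun z => z.1 • nuv lam + z.2 • nupv lam
  set S : Set (ℝ × ℝ) := Icc (-(1 / 2)) (1 / 2) ×ˢ Icc (-(1 / 2)) (1 / 2)
  have hT : Continuous T := by fun_prop
  have hK : IsCompact (T '' S) := (isCompact_Icc.prod isCompact_Icc).image hT
  have hsub : Qlam lam ⊆ T '' S := fun y hy => by
    have h1 := abs_lt.1 hy.1
    have h2 := abs_lt.1 hy.2
    exact ⟨(dotp (nuv lam) y, dotp (nupv lam) y), ⟨⟨h1.1.le, h1.2.le⟩, ⟨h2.1.le, h2.2.le⟩⟩,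
      rot_dotp lam y⟩
  obtain ⟨C, hC⟩ := hK.exists_bound_of_continuousOn hf.continuousOn
  calc ∫⁻ y in Qlam lam, ENNReal.ofReal (f y)
      ≤ ∫⁻ y in T '' S, ENNReal.ofReal (f y) := lintegral_mono_set hsub
    _ ≤ ∫⁻ y in T '' S, ENNReal.ofReal C := setLIntegral_mono' hK.measurableSet fun y hy =>
        ENNReal.ofReal_le_ofReal ((le_abs_self _).trans (hC y hy))
    _ < ⊤ := by
        rw [setLIntegral_const]
        exact ENNReal.mul_lt_top ENNReal.ofReal_lt_top hK.measure_lt_top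

theorem setLIntegral_Qlam_comp_neg (lam : ℝ) {g : Pt2 → ℝ≥0∞} (hg : Measurable g) :
    ∫⁻ y in Qlam lam, g (-y) = ∫⁻ y in Qlam lam, g y := by
  have h := (Measure.measurePreserving_neg (volume : Measure Pt2)).setLIntegral_comp_preimage
    (isOpen_Qlam lam).measurableSet hg
  rw [← h]
  congr 2
  ext y
  have : ∀ w, dotp w (-y) = -dotp w y := fun w => by
    simp only [dotp, Prod.fst_neg, Prod.snd_neg]; ring
  simp [Qlam, this]

theorem exists_profile {W : M33 → ℝ} (hW : Continuous W) (a : V3) (lam ℓ : ℝ) {v : Pt2 → V3}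
    (hv : ContDiff ℝ 2 v) (hper : ∀ y : Pt2, v (y + nupv lam) = v y)
    (hR : ∃ δ > (0 : ℝ), ∀ y : Pt2, |dotp (nuv lam) y - 1 / 2| < δ →
      qd f1 v y = a ∧ qd f2 v y = lam • a)
    (hL : ∃ δ > (0 : ℝ), ∀ y : Pt2, |dotp (nuv lam) y + 1 / 2| < δ →
      qd f1 v y = -a ∧ qd f2 v y = -(lam • a)) {τ : ℝ} (hτ : τ = 1 ∨ τ = -1) :
    ∃ G : Pt2 → V3, IsProfile a lam τ G ∧
      ∫⁻ y in Qlam lam, ENNReal.ofReal (cellDensity W a lam τ ℓ G y) =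
        ∫⁻ y in Qlam lam, ENNReal.ofReal (ℓ * W2 W v y + ℓ⁻¹ * hess2d v y) := by
  obtain ⟨G, hG, hE⟩ := exists_profile_of_competitor a lam hv hper hR hL
  have hEG : ∫⁻ y in Qlam lam, ENNReal.ofReal (cellDensity W a lam (-1) ℓ G y) =
        ∫⁻ y in Qlam lam, ENNReal.ofReal (ℓ * W2 W v y + ℓ⁻¹ * hess2d v y) :=
    setLIntegral_congr_fun (isOpen_Qlam lam).measurableSet fun y hy => by
      simp only [hE W ℓ y hy]
  rcases hτ with rfl | rfl
  · obtain ⟨G', hG', hE'⟩ := hG.reflect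
    refine ⟨G', hG', ?_⟩
    simp only [hE']
    rw [← hEG]
    exact setLIntegral_Qlam_comp_neg lam
      (continuous_cellDensity hW a lam (-1) ℓ hG.contDiff).measurable.ennreal_ofReal
  · exact ⟨G, hG, hEG⟩

theorem volume_slice_ne_top {ω : Set (ℝ × ℝ)} (h : Bornology.IsBounded ω) (c : ℝ) :
    volume {t : ℝ | (c, t) ∈ ω} ≠ ⊤ := by
  have : Bornology.IsBounded {t : ℝ | (c, t) ∈ ω} :=
    (LipschitzWith.prod_snd.isBounded_image h).subset fun t ht => ⟨(c, t), ht, rfl⟩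
  exact this.measure_lt_top.ne

section

variable {a : V3} {lam σ : ℝ} {m : ℕ} {α : Fin m → ℝ} {G : Fin m → Pt2 → V3} {W : M33 → ℝ}
  {ω : Set (ℝ × ℝ)} {ℓ : ℝ} {h ε : ℕ → ℝ} {E : ℝ≥0∞}

theorem eventually_F_recovery_le (hWc : Continuous W) (hW : ∀ ξ, 0 ≤ W ξ)
    (hWp : W ![a, 0, lam • a] = 0) (hWm : W ![-a, 0, -(lam • a)] = 0)
    (hωo : IsOpen ω) (hωc : Convex ℝ ω) (hωne : ω.Nonempty) (hα : StrictMono α)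
    (hαin : ∀ i, sInf (Prod.fst '' ω) < α i ∧ α i < sSup (Prod.fst '' ω))
    (hσ : σ = 1 ∨ σ = -1) (hℓ : 0 < ℓ) (hh : ∀ n, 0 < h n) (hε : ∀ n, 0 < ε n)
    (hh0 : Tendsto h atTop (𝓝 0)) (hε0 : Tendsto ε atTop (𝓝 0))
    (hG : ∀ i : Fin m, IsProfile a lam (σ * (-1) ^ (i : ℕ)) (G i))
    (hE : ∀ i : Fin m, ∫⁻ y in Qlam lam,
      ENNReal.ofReal (cellDensity W a lam (σ * (-1) ^ (i : ℕ)) ℓ (G i) y) = E)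
    {c : Fin m → ℝ≥0∞} (hc : ∀ i, volume {t : ℝ | (α i, t) ∈ ω} < c i) (hct : ∀ i, c i ≠ ⊤)
    (k : V3) :
    ∀ᶠ n in atTop, F W (h n) (ε n) (recovery a lam σ (ℓ * ε n) (h n) k α G) (Om ω) ≤
      (∑ i, c i) * (ENNReal.ofReal (√(1 + lam ^ 2) + ℓ * (h n / ε n)⁻¹) * E) := by
  have hs := sqrt_one_add_sq_pos lam
  have hslice : ∀ i, ∃ r > 0, ∀ x, |x - α i| < r → volume {t : ℝ | (x, t) ∈ ω} ≤ c i := fun i => by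
    obtain ⟨r, hr, hr'⟩ := Metric.eventually_nhds_iff.1
      (hωc.eventually_volume_slice_le (hαin i) hωne (hc i))
    exact ⟨r, hr, fun x hx => hr' (by rwa [Real.dist_eq])⟩
  choose r hr hslice using hslice
  have hδ0 : Tendsto (fun n => √(1 + lam ^ 2) * (ℓ * ε n)) atTop (𝓝 0) := by
    simpa using (hε0.const_mul ℓ).const_mul (√(1 + lam ^ 2))
  have hrt : Tendsto (fun n => √(1 + lam ^ 2) * (ℓ * ε n) / 2 + |lam| * h n / 2) atTop (𝓝 0) := by
    simpa using (hδ0.div_const 2).add ((hh0.const_mul |lam|).div_const 2)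
  have ev1 : ∀ᶠ n in atTop, ∀ i,
      √(1 + lam ^ 2) * (ℓ * ε n) / 2 + |lam| * h n / 2 ≤ r i :=
    eventually_all.2 fun i => hrt.eventually_le_const (hr i)
  have ev2 : ∀ᶠ n in atTop, ∀ i j, i < j → √(1 + lam ^ 2) * (ℓ * ε n) ≤ α j - α i :=
    eventually_all.2 fun i => eventually_all.2 fun j => by
      by_cases hij : i < j
      · filter_upwards [hδ0.eventually_le_const (sub_pos.2 (hα hij))] with n hn _ using hn
      · exact Eventually.of_forall fun n hc => absurd hc hij
  filter_upwards [ev1, ev2] with n hn1 hn2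
  have hδ : 0 < ℓ * ε n := mul_pos hℓ (hε n)
  set g : Fin m → Pt2 → ℝ≥0∞ := fun i y =>
    ENNReal.ofReal (cellDensity W a lam (σ * (-1) ^ (i : ℕ)) ℓ (G i) y) with hg
  have hτ : ∀ n : ℕ, σ * (-1) ^ n = 1 ∨ σ * (-1) ^ n = -1 := fun n => by
    rcases neg_one_pow_eq_or ℝ n with e | e <;> rcases hσ with r | r <;> simp [e, r]
  have hgm : ∀ i, Measurable (g i) := fun i =>
    (continuous_cellDensity hWc a lam _ ℓ (hG i).contDiff).measurable.ennreal_ofReal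
  have hgb : ∀ i, Measurable fun x : Pt => g i (blowup (ℓ * ε n) (h n) (α i) x) := fun i =>
    (hgm i).comp (contDiff_blowup _ _ _).continuous.measurable
  calc F W (h n) (ε n) (recovery a lam σ (ℓ * ε n) (h n) k α G) (Om ω)
      ≤ ∫⁻ x in Om ω, ∑ i, ENNReal.ofReal (ℓ * ε n)⁻¹ *
          g i (blowup (ℓ * ε n) (h n) (α i) x) := by
        refine lintegral_mono fun x => ?_
        refine (ENNReal.ofReal_le_ofReal (density_recovery_le hW hWp hWm hσ hℓ (hε n) (hh n).ne'
          hn2 hα.monotone hG k x)).trans ?_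
        rw [ENNReal.ofReal_sum_of_nonneg fun i _ => mul_nonneg (inv_pos.2 (hε n)).le
          (mul_nonneg (inv_pos.2 hℓ).le (cellDensity_nonneg hW _ _ _ hℓ _ _))]
        refine Finset.sum_le_sum fun i _ => ?_
        rw [← mul_assoc, ← mul_inv_rev, ENNReal.ofReal_mul (inv_pos.2 hδ).le]
    _ = ∑ i, ENNReal.ofReal (ℓ * ε n)⁻¹ *
          ∫⁻ x in Om ω, g i (blowup (ℓ * ε n) (h n) (α i) x) := by
        rw [lintegral_finsetSum _ fun i _ => (hgb i).const_mul _]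
        exact Finset.sum_congr rfl fun i _ => lintegral_const_mul _ (hgb i)
    _ ≤ ∑ i, ENNReal.ofReal (ℓ * ε n)⁻¹ * (c i * (ENNReal.ofReal ((ℓ * ε n) ^ 2 / h n) *
          (ENNReal.ofReal (√(1 + lam ^ 2) * h n / (ℓ * ε n) + 1) * E))) := by
        refine Finset.sum_le_sum fun i _ => mul_le_mul_right ?_ _
        rw [← hE i]
        exact lintegral_layer_le hωo lam (α i) hδ (hh n) (hct i) (hslice i) (hn1 i) (hgm i)
          (fun y => by simp only [hg, (hG i).cellDensity_periodic])
          (fun y hy => by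
            simp only [hg, (hG i).cellDensity_eq_zero (hτ i) hWp hWm ℓ hy, ENNReal.ofReal_zero])
    _ = _ := by
        rw [Finset.sum_mul]
        refine Finset.sum_congr rfl fun i _ => ?_
        have : √(1 + lam ^ 2) + ℓ * (h n / ε n)⁻¹ = (ℓ * ε n)⁻¹ * ((ℓ * ε n) ^ 2 / h n *
            (√(1 + lam ^ 2) * h n / (ℓ * ε n) + 1)) := by
          have := (hh n).ne'
          have := (hε n).ne'
          field_simp
        rw [this, ENNReal.ofReal_mul (inv_pos.2 hδ).le, ENNReal.ofReal_mul (by have := hh n; positivity)]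
        ring

theorem eventually_F_recovery_le_of_lt (hWc : Continuous W) (hW : ∀ ξ, 0 ≤ W ξ)
    (hWp : W ![a, 0, lam • a] = 0) (hWm : W ![-a, 0, -(lam • a)] = 0)
    (hωo : IsOpen ω) (hωc : Convex ℝ ω) (hωb : Bornology.IsBounded ω) (hωne : ω.Nonempty)
    (hα : StrictMono α)
    (hαin : ∀ i, sInf (Prod.fst '' ω) < α i ∧ α i < sSup (Prod.fst '' ω))
    (hσ : σ = 1 ∨ σ = -1) (hℓ : 0 < ℓ) (hh : ∀ n, 0 < h n) (hε : ∀ n, 0 < ε n)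
    (hh0 : Tendsto h atTop (𝓝 0)) (hε0 : Tendsto ε atTop (𝓝 0))
    (hratio : Tendsto (fun n => h n / ε n) atTop atTop)
    (hG : ∀ i : Fin m, IsProfile a lam (σ * (-1) ^ (i : ℕ)) (G i))
    (hE : ∀ i : Fin m, ∫⁻ y in Qlam lam,
      ENNReal.ofReal (cellDensity W a lam (σ * (-1) ^ (i : ℕ)) ℓ (G i) y) = E) (hEt : E ≠ ⊤)
    {b : ℝ≥0∞} (hb : ENNReal.ofReal √(1 + lam ^ 2) * E *
      ∑ i : Fin m, volume {t : ℝ | (α i, t) ∈ ω} < b) (k : V3) :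
    ∀ᶠ n in atTop,
      F W (h n) (ε n) (recovery a lam σ (ℓ * ε n) (h n) k α G) (Om ω) ≤ b := by
  have hLt := fun i => volume_slice_ne_top hωb (α i)
  have h1 : Tendsto (fun j : ℕ => ENNReal.ofReal √(1 + lam ^ 2) * E *
      ∑ i : Fin m, (volume {t : ℝ | (α i, t) ∈ ω} + (j + 1 : ℝ≥0∞)⁻¹)) atTop
      (𝓝 (ENNReal.ofReal √(1 + lam ^ 2) * E * ∑ i : Fin m, (volume {t : ℝ | (α i, t) ∈ ω} + 0))) := by
    refine ENNReal.Tendsto.const_mul (tendsto_finsetSum _ fun i _ => ?_)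
      (Or.inr (ENNReal.mul_ne_top ENNReal.ofReal_ne_top hEt))
    exact tendsto_const_nhds.add tendsto_inv_succ
  simp only [add_zero] at h1
  obtain ⟨j, hj⟩ := (h1.eventually_lt_const hb).exists
  set c : Fin m → ℝ≥0∞ := fun i => volume {t : ℝ | (α i, t) ∈ ω} + (j + 1 : ℝ≥0∞)⁻¹
  have hη : (j + 1 : ℝ≥0∞)⁻¹ ≠ 0 := ENNReal.inv_ne_zero.2 (by finiteness)
  have hηt : (j + 1 : ℝ≥0∞)⁻¹ ≠ ⊤ := ENNReal.inv_ne_top.2 (by simp)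
  have hct : ∀ i, c i ≠ ⊤ := fun i => ENNReal.add_ne_top.2 ⟨hLt i, hηt⟩
  have h2 : Tendsto (fun n => (∑ i, c i) *
      (ENNReal.ofReal (√(1 + lam ^ 2) + ℓ * (h n / ε n)⁻¹) * E)) atTop
      (𝓝 ((∑ i, c i) * (ENNReal.ofReal √(1 + lam ^ 2) * E))) := by
    refine ENNReal.Tendsto.const_mul (ENNReal.Tendsto.mul_const (ENNReal.tendsto_ofReal ?_)
      (Or.inr hEt)) (Or.inr (ENNReal.sum_ne_top.2 fun i _ => hct i))
    simpa using ((tendsto_inv_atTop_zero.comp hratio).const_mul ℓ).const_add √(1 + lam ^ 2)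
  rw [mul_comm] at hj
  filter_upwards [h2.eventually_lt_const hj, eventually_F_recovery_le hWc hW hWp hWm hωo hωc hωne hα
    hαin hσ hℓ hh hε hh0 hε0 hG hE (c := c) (fun i => ENNReal.lt_add_right (hLt i) hη) hct k]
    with n hn1 hn2 using hn2.trans hn1.le

end

/-- Diagonal selection. -/
theorem exists_diagonal {X : Type*} [Nonempty X] {Q : ℕ → ℕ → X → Prop}
    (h : ∀ k, ∀ᶠ n in atTop, ∃ x, Q k n x) :
    ∃ x : ℕ → X, ∀ k, ∀ᶠ n in atTop, ∃ j ≥ k, Q j n (x n) := by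
  classical
  set K : ℕ → ℕ := fun n => Nat.findGreatest (fun j => ∃ x, Q j n x) n
  refine ⟨fun n => Classical.epsilon (Q (K n) n), fun k => ?_⟩
  filter_upwards [h k, eventually_ge_atTop k] with n hn hkn
  exact ⟨K n, Nat.le_findGreatest hkn hn,
    Classical.epsilon_spec (Nat.findGreatest_spec (P := fun j => ∃ x, Q j n x) hkn hn)⟩

theorem limsup_le_of_eventually_le_add_inv {f : ℕ → ℝ≥0∞} {c : ℝ≥0∞}
    (h : ∀ k : ℕ, ∀ᶠ n in atTop, ∃ j ≥ k, f n ≤ c + (j + 1 : ℝ≥0∞)⁻¹) :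
    limsup f atTop ≤ c := by
  have h1 : Tendsto (fun k : ℕ => c + (k + 1 : ℝ≥0∞)⁻¹) atTop (𝓝 (c + 0)) :=
    tendsto_const_nhds.add tendsto_inv_succ
  rw [add_zero] at h1
  refine ge_of_tendsto' h1 fun k => limsup_le_of_le (by isBoundedDefault) ?_
  filter_upwards [h k] with n ⟨j, hj, hn⟩
  refine hn.trans ?_
  gcongr

theorem tendsto_zero_of_eventually_le_inv {f : ℕ → ℝ≥0∞}
    (h : ∀ k : ℕ, ∀ᶠ n in atTop, ∃ j ≥ k, f n ≤ (j + 1 : ℝ≥0∞)⁻¹) :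
    Tendsto f atTop (𝓝 0) :=
  tendsto_of_le_liminf_of_limsup_le zero_le
    (limsup_le_of_eventually_le_add_inv fun k => by simpa using h k)

/-- Theorem 6.7, upper bound in the supercritical regime,
laminate case. -/
theorem statement17 (p : ℝ) (hp : 2 ≤ p) (A B : M33) (W : M33 → ℝ)
    (a : V3) (ha : a ≠ 0) (lam : ℝ)
    (hWc : Continuous W) (h1 : H1 W A B) (h2 : H2 W p) (h3 : H3 W A B p) (h4 : H4 W)
    (hAB : A = -B) (hA0 : A 0 = a) (hA1 : A 1 = 0) (hA2 : A 2 = lam • a)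
    (ω : Set (ℝ × ℝ)) (hωo : IsOpen ω) (hωc : Convex ℝ ω)
    (hωb : Bornology.IsBounded ω) (hωne : ω.Nonempty)
    (m : ℕ) (hm : 0 < m) (α : Fin m → ℝ) (hαmono : StrictMono α)
    (hαin : ∀ i, sInf (Prod.fst '' ω) < α i ∧ α i < sSup (Prod.fst '' ω))
    (σ : ℝ) (hσ : σ = 1 ∨ σ = -1)
    (ubar : ℝ → V3) (hubarc : Continuous ubar)
    (hubar : ∀ t, t ∉ Set.range α →
      HasDerivAt ubar ((σ * (-1 : ℝ) ^ (cnt m α t)) • a) t)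
    (h ε : ℕ → ℝ) (hh : ∀ n, 0 < h n) (hε : ∀ n, 0 < ε n)
    (hh0 : Tendsto h atTop (nhds 0)) (hε0 : Tendsto ε atTop (nhds 0))
    (hratio : Tendsto (fun n => h n / ε n) atTop atTop) :
    ∃ un : ℕ → Pt → V3, (∀ n, ContDiff ℝ 2 (un n)) ∧
      Tendsto (fun n => ∫⁻ x in Om ω, ENNReal.ofReal
          ((vnorm (un n x - ubar x.1)) ^ p
            + (vnorm (pd e1 (un n) x - (σ * (-1 : ℝ) ^ (cnt m α x.1)) • a)) ^ p
            + (vnorm (pd e2 (un n) x)) ^ p)) atTop (nhds 0) ∧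
      TendsLp (Om ω) p (fun n x => (h n)⁻¹ • pd e3 (un n) x)
        (fun x => (σ * (-1 : ℝ) ^ (cnt m α x.1)) • A 2) ∧
      Filter.limsup (fun n => F W (h n) (ε n) (un n) (Om ω)) atTop ≤
        KinfL W a lam * ∑ i : Fin m, volume {t : ℝ | (α i, t) ∈ ω} := by
  have hA : A = ![a, 0, lam • a] := by
    funext j; fin_cases j <;> simp [hA0, hA1, hA2]
  have hB : B = ![-a, 0, -(lam • a)] := by
    rw [← neg_neg B, ← hAB, hA]; simp
  have hWp : W ![a, 0, lam • a] = 0 := (h1.2.1 _).2 (Or.inl hA.symm)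
  have hWm : W ![-a, 0, -(lam • a)] = 0 := (h1.2.1 _).2 (Or.inr hB.symm)
  have hW := h1.1
  rw [hA2]
  obtain ⟨k, hk⟩ := exists_laminate_eq hαmono.monotone hubarc hubar
  set L : ℝ≥0∞ := ∑ i : Fin m, volume {t : ℝ | (α i, t) ∈ ω}
  have hLt : L ≠ ⊤ := ENNReal.sum_ne_top.2 fun i _ => volume_slice_ne_top hωb (α i)
  unfold KinfL
  set S : Set ℝ≥0∞ := { L : ℝ≥0∞ | ∃ ℓ > (0 : ℝ), ∃ v : Pt2 → V3,
      ContDiff ℝ 2 v ∧ (∀ y : Pt2, v (y + nupv lam) = v y) ∧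
      (∃ δ > (0 : ℝ), ∀ y : Pt2, |dotp (nuv lam) y - 1 / 2| < δ →
        qd f1 v y = a ∧ qd f2 v y = lam • a) ∧
      (∃ δ > (0 : ℝ), ∀ y : Pt2, |dotp (nuv lam) y + 1 / 2| < δ →
        qd f1 v y = -a ∧ qd f2 v y = -(lam • a)) ∧
      L = ∫⁻ y in Qlam lam, ENNReal.ofReal (ℓ * W2 W v y + ℓ⁻¹ * hess2d v y) } with hS
  have hSne : S.Nonempty := by
    obtain ⟨v, hv⟩ := exists_competitor a lam
    exact ⟨_, 1, one_pos, v, hv.1, hv.2.1, hv.2.2.1, hv.2.2.2, rfl⟩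
  have hτ : ∀ n : ℕ, σ * (-1) ^ n = 1 ∨ σ * (-1) ^ n = -1 := fun n => by
    rcases neg_one_pow_eq_or ℝ n with e | e <;> rcases hσ with r | r <;> simp [e, r]
  have hSlt : ∀ E ∈ S, E ≠ ⊤ := by
    rintro E ⟨ℓ, hℓ, v, hv, hper, hR, hL, rfl⟩
    obtain ⟨G, hG, hGE⟩ := exists_profile hWc a lam ℓ hv hper hR hL (Or.inl rfl)
    rw [← hGE]
    exact (setLIntegral_Qlam_lt_top lam (continuous_cellDensity hWc a lam 1 ℓ hG.contDiff)).ne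
  set q1 : (Pt → V3) → ℝ≥0∞ := fun u => ∫⁻ x in Om ω, ENNReal.ofReal
          ((vnorm (u x - ubar x.1)) ^ p
            + (vnorm (pd e1 u x - (σ * (-1 : ℝ) ^ (cnt m α x.1)) • a)) ^ p
            + (vnorm (pd e2 u x)) ^ p)
  set q2 : ℕ → (Pt → V3) → ℝ≥0∞ := fun n u => ∫⁻ x in Om ω, ENNReal.ofReal
    ((vnorm ((h n)⁻¹ • pd e3 u x - (σ * (-1 : ℝ) ^ (cnt m α x.1)) • (lam • a))) ^ p)
  set M : ℝ≥0∞ := ENNReal.ofReal √(1 + lam ^ 2) * sInf S * L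
  have hM : M ≠ ⊤ := by
    obtain ⟨E, hE⟩ := hSne
    exact ENNReal.mul_ne_top (ENNReal.mul_ne_top ENNReal.ofReal_ne_top
      (ne_top_of_le_ne_top (hSlt E hE) (sInf_le hE))) hLt
  have key : ∀ j : ℕ, ∀ᶠ n in atTop, ∃ u : Pt → V3, ContDiff ℝ 2 u ∧
      q1 u ≤ (j + 1 : ℝ≥0∞)⁻¹ ∧ q2 n u ≤ (j + 1 : ℝ≥0∞)⁻¹ ∧
      F W (h n) (ε n) u (Om ω) ≤ M + (j + 1 : ℝ≥0∞)⁻¹ := by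
    intro j
    have hη : (0 : ℝ≥0∞) < (j + 1 : ℝ≥0∞)⁻¹ := ENNReal.inv_pos.2 (by finiteness)
    obtain ⟨E, hES, hEb⟩ : ∃ E ∈ S, ENNReal.ofReal √(1 + lam ^ 2) * E * L <
        M + (j + 1 : ℝ≥0∞)⁻¹ := by
      obtain ⟨s, -, hs, hsS⟩ := exists_seq_tendsto_sInf hSne (OrderBot.bddBelow S)
      have ht := ENNReal.Tendsto.mul_const (b := L) (ENNReal.Tendsto.const_mul hs
        (Or.inr (ENNReal.ofReal_ne_top (r := √(1 + lam ^ 2))))) (Or.inr hLt)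
      obtain ⟨i, hi⟩ := (ht.eventually_lt_const (ENNReal.lt_add_right hM hη.ne')).exists
      exact ⟨s i, hsS i, hi⟩
    have hEt := hSlt E hES
    obtain ⟨ℓ, hℓ, v, hv, hper, hR, hL, hE⟩ := hES
    choose G hG hGE using fun i : Fin m =>
      exists_profile hWc a lam ℓ hv hper hR hL (hτ i)
    have hδ0 : Tendsto (fun n => ℓ * ε n) atTop (𝓝 0) := by simpa using hε0.const_mul ℓ
    obtain ⟨t1, t2⟩ := tendsto_recovery hωo hωb (by linarith : 0 < p) hσ hαmono.monotone hk hG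
      (fun n => mul_pos hℓ (hε n)) hh hδ0 hh0
    filter_upwards [t1.eventually_le_const hη, t2.eventually_le_const hη,
      eventually_F_recovery_le_of_lt hWc hW hWp hWm hωo hωc hωb hωne hαmono hαin hσ hℓ hh hε hh0
        hε0 hratio hG (fun i => (hGE i).trans hE.symm) hEt hEb k] with n hn1 hn2 hn3
    exact ⟨_, contDiff_recovery fun i => (hG i).contDiff, hn1, hn2, hn3⟩
  have : Nonempty {u : Pt → V3 // ContDiff ℝ 2 u} := ⟨⟨fun _ => 0, contDiff_const⟩⟩
  obtain ⟨u, hu⟩ := exists_diagonal (X := {u : Pt → V3 // ContDiff ℝ 2 u})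
    (Q := fun j n u => q1 u ≤ (j + 1 : ℝ≥0∞)⁻¹ ∧ q2 n u ≤ (j + 1 : ℝ≥0∞)⁻¹ ∧
      F W (h n) (ε n) u (Om ω) ≤ M + (j + 1 : ℝ≥0∞)⁻¹)
    (fun j => (key j).mono fun n ⟨u, hu, hq⟩ => ⟨⟨u, hu⟩, hq⟩)
  exact ⟨fun n => u n, fun n => (u n).2,
    tendsto_zero_of_eventually_le_inv fun j => (hu j).mono fun n ⟨i, hi, hq⟩ => ⟨i, hi, hq.1⟩,
    tendsto_zero_of_eventually_le_inv fun j => (hu j).mono fun n ⟨i, hi, hq⟩ => ⟨i, hi, hq.2.1⟩,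
    limsup_le_of_eventually_le_add_inv fun j =>
      (hu j).mono fun n ⟨i, hi, hq⟩ => ⟨i, hi, hq.2.2⟩⟩
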